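/- arXiv:gr-qc/0201046 — 2 statements merged into one kernel-verified Lean document; each statement's English description precedes it below -/
import Mathlib

section
/- Let c > 0 be such that H̄(c) := lim_{ρ→ρ₁(c)⁻} H(ρ) = 0. Then the c-orbit extends to a solution that is real-analytic on the whole closed interval [0, ρ₁(c)]; in particular H, H′, A and Z have finite limits at ρ₁(c) and the extended functions are analytic at ρ = ρ₁(c). -/
open Real Filter Set Topology Asymptotics MeasureTheory

noncomputable section

/-- The CSS (continuously self-similar) system for `(H, A, Z)` with derivative
function `H'`, on the interval `(0, ρ₁)`, together with the constraint, the
positivity/range conditions, and the initial conditions at `ρ = 0`: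
`H(0) = -π/2`, `H'(0) = c`, `A(0) = 1`, `Z(0) = 0`, `Z'(0) = 1`.  This is the
notion of a `c`-orbit. -/
structure IsCOrbit (α c : ℝ) (H H' A Z : ℝ → ℝ) (ρ₁ : ℝ) : Prop where
  rho1_pos : 0 < ρ₁
  hH : ∀ ρ ∈ Set.Ioo 0 ρ₁, HasDerivAt H (H' ρ) ρ
  hH' : ∀ ρ ∈ Set.Ioo 0 ρ₁, HasDerivAt H'
      (α * (1 + Z ρ ^ 2) * ρ * H' ρ ^ 3 - (2 / ρ) * H' ρ
        - Real.sin (2 * H ρ) / (A ρ * ρ ^ 2 * (1 - Z ρ ^ 2))) ρ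
  hA : ∀ ρ ∈ Set.Ioo 0 ρ₁, HasDerivAt A (-2 * α * ρ * A ρ * H' ρ ^ 2) ρ
  hZ : ∀ ρ ∈ Set.Ioo 0 ρ₁, HasDerivAt Z
      (Z ρ * (1 + α * (1 - Z ρ ^ 2) * ρ ^ 2 * H' ρ ^ 2) / ρ) ρ
  constraint : ∀ ρ ∈ Set.Ioo 0 ρ₁,
      1 - 2 * α - A ρ + 2 * α * Real.sin (H ρ) ^ 2
        + α * A ρ * ρ ^ 2 * H' ρ ^ 2 * (1 - Z ρ ^ 2) = 0
  hApos : ∀ ρ ∈ Set.Ioo 0 ρ₁, 0 < A ρ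
  hZ01 : ∀ ρ ∈ Set.Ioo 0 ρ₁, 0 ≤ Z ρ ∧ Z ρ < 1
  H0 : H 0 = -(π / 2)
  A0 : A 0 = 1
  Z0 : Z 0 = 0
  Hcont : Tendsto H (𝓝[>] 0) (𝓝 (-(π / 2)))
  H'init : Tendsto H' (𝓝[>] 0) (𝓝 c)
  Acont : Tendsto A (𝓝[>] 0) (𝓝 1)
  Zcont : Tendsto Z (𝓝[>] 0) (𝓝 0)
  Z'init : Tendsto (fun ρ => Z ρ / ρ) (𝓝[>] 0) (𝓝 1)

theorem differentiableOn_integral_pow_mul_comp_smul (m : ℕ) {f : ℂ → ℂ} {r : ℝ}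
    (hf : DifferentiableOn ℂ f (Metric.ball 0 r)) :
    DifferentiableOn ℂ (fun z => ∫ θ in (0 : ℝ)..1, (θ : ℂ) ^ m * f (θ * z))
      (Metric.ball 0 r) := by
  intro z hz
  have hz' : ‖z‖ < r := by simpa using hz
  obtain ⟨s, hzs, hsr⟩ := exists_between hz'
  have hmem : ∀ θ ∈ Icc (0 : ℝ) 1, ∀ x ∈ Metric.ball (0 : ℂ) s,
      (θ : ℂ) * x ∈ Metric.closedBall (0 : ℂ) s := by
    intro θ hθ x hx
    have hx' : ‖x‖ < s := by simpa using hx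
    simp only [mem_closedBall_zero_iff, norm_mul, Complex.norm_real, Real.norm_eq_abs,
      abs_of_nonneg hθ.1]
    nlinarith [hθ.2, norm_nonneg x]
  have hsub : Metric.closedBall (0 : ℂ) s ⊆ Metric.ball 0 r :=
    Metric.closedBall_subset_ball hsr
  have hd : DifferentiableOn ℂ (deriv f) (Metric.ball 0 r) := hf.deriv Metric.isOpen_ball
  obtain ⟨M, hM⟩ := (isCompact_closedBall (0 : ℂ) s).exists_bound_of_continuousOn
    (hd.continuousOn.mono hsub)
  have hpath : ∀ x : ℂ, ContinuousOn (fun θ : ℝ => (θ : ℂ) * x) (Icc 0 1) := fun x => by fun_prop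
  have hcF : ∀ x ∈ Metric.ball (0 : ℂ) s,
      ContinuousOn (fun θ : ℝ => (θ : ℂ) ^ m * f (θ * x)) (Icc 0 1) := by
    intro x hx
    refine ContinuousOn.mul (by fun_prop) ?_
    exact hf.continuousOn.comp (hpath x) fun θ hθ => hsub (hmem θ hθ x hx)
  have hcF' : ∀ x ∈ Metric.ball (0 : ℂ) s,
      ContinuousOn (fun θ : ℝ => (θ : ℂ) ^ m * (θ * deriv f (θ * x))) (Icc 0 1) := by
    intro x hx
    refine ContinuousOn.mul (by fun_prop) (ContinuousOn.mul (by fun_prop) ?_)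
    exact hd.continuousOn.comp (hpath x) fun θ hθ => hsub (hmem θ hθ x hx)
  have hIoc : Set.uIoc (0 : ℝ) 1 = Ioc 0 1 := uIoc_of_le zero_le_one
  have hs : Metric.ball (0 : ℂ) s ∈ 𝓝 z := Metric.isOpen_ball.mem_nhds (by simpa using hzs)
  have key := intervalIntegral.hasDerivAt_integral_of_dominated_loc_of_deriv_le
    (μ := volume) (a := 0) (b := 1) (bound := fun _ => M)
    (F := fun x (θ : ℝ) => (θ : ℂ) ^ m * f (θ * x))
    (F' := fun x (θ : ℝ) => (θ : ℂ) ^ m * (θ * deriv f (θ * x))) hs ?_ ?_ ?_ ?_ ?_ ?_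
  · exact key.2.differentiableAt.differentiableWithinAt
  · filter_upwards [hs] with x hx
    rw [hIoc]
    exact ((hcF x hx).mono Ioc_subset_Icc_self).aestronglyMeasurable measurableSet_Ioc
  · apply ContinuousOn.intervalIntegrable
    rw [uIcc_of_le zero_le_one]
    exact hcF z (by simpa using hzs)
  · rw [hIoc]
    exact ((hcF' z (by simpa using hzs)).mono Ioc_subset_Icc_self).aestronglyMeasurable
      measurableSet_Ioc
  · refine Eventually.of_forall fun θ hθ x hx => ?_
    rw [hIoc] at hθ
    have h1 := hM _ (hmem θ (Ioc_subset_Icc_self hθ) x hx)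
    have hθ1 : ‖(θ : ℂ)‖ ≤ 1 := by
      simpa [abs_of_pos hθ.1] using hθ.2
    calc ‖(θ : ℂ) ^ m * (θ * deriv f (θ * x))‖
        = ‖(θ : ℂ)‖ ^ m * (‖(θ : ℂ)‖ * ‖deriv f (θ * x)‖) := by simp
      _ ≤ 1 * (1 * M) := by
        gcongr
        exact pow_le_one₀ (norm_nonneg _) hθ1
      _ = M := by ring
  · simp
  · refine Eventually.of_forall fun θ hθ x hx => ?_
    rw [hIoc] at hθ
    have h1 : HasDerivAt f (deriv f (θ * x)) (θ * x) :=
      ((hf _ (hsub (hmem θ (Ioc_subset_Icc_self hθ) x hx))).differentiableAt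
        (Metric.isOpen_ball.mem_nhds (hsub (hmem θ (Ioc_subset_Icc_self hθ) x hx)))).hasDerivAt
    have h2 : HasDerivAt (fun x : ℂ => (θ : ℂ) * x) θ x := by
      simpa using (hasDerivAt_id x).const_mul (θ : ℂ)
    have h3 := (h1.comp x h2).const_mul ((θ : ℂ) ^ m)
    refine h3.congr_deriv ?_
    ring

theorem norm_integral_pow_mul_le (m : ℕ) {a : ℝ → ℂ} {C : ℝ}
    (h : ∀ θ ∈ Ioc (0 : ℝ) 1, ‖a θ‖ ≤ C) :
    ‖∫ θ in (0 : ℝ)..1, (θ : ℂ) ^ m * a θ‖ ≤ C := by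
  have := intervalIntegral.norm_integral_le_of_norm_le_const (a := (0 : ℝ)) (b := 1) (C := C)
    (f := fun θ : ℝ => (θ : ℂ) ^ m * a θ) ?_
  · simpa using this
  · intro θ hθ
    rw [uIoc_of_le zero_le_one] at hθ
    have hθ1 : ‖(θ : ℂ)‖ ≤ 1 := by
      simpa [abs_of_pos hθ.1] using hθ.2
    calc ‖(θ : ℂ) ^ m * a θ‖ = ‖(θ : ℂ)‖ ^ m * ‖a θ‖ := by simp
      _ ≤ 1 * C := by
        gcongr
        · exact pow_le_one₀ (norm_nonneg _) hθ1
        · exact h θ hθ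
      _ = C := one_mul C

theorem intervalIntegrable_pow_mul (m : ℕ) {a : ℝ → ℂ} {C : ℝ}
    (hc : ContinuousOn a (Ioc 0 1)) (h : ∀ θ ∈ Ioc (0 : ℝ) 1, ‖a θ‖ ≤ C) :
    IntervalIntegrable (fun θ : ℝ => (θ : ℂ) ^ m * a θ) volume 0 1 := by
  rw [intervalIntegrable_iff_integrableOn_Ioc_of_le zero_le_one]
  refine Integrable.of_bound (C := C) ?_ ?_
  · have hp : ContinuousOn (fun θ : ℝ => (θ : ℂ) ^ m) (Ioc 0 1) := by fun_prop
    exact (hp.mul hc).aestronglyMeasurable measurableSet_Ioc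
  · refine (ae_restrict_iff' measurableSet_Ioc).2 (Eventually.of_forall fun θ hθ => ?_)
    have hθ1 : ‖(θ : ℂ)‖ ≤ 1 := by
      simpa [abs_of_pos hθ.1] using hθ.2
    calc ‖(θ : ℂ) ^ m * a θ‖ = ‖(θ : ℂ)‖ ^ m * ‖a θ‖ := by simp
      _ ≤ 1 * C := by
        gcongr
        · exact pow_le_one₀ (norm_nonneg _) hθ1
        · exact h θ hθ
      _ = C := one_mul C

theorem integral_eq_of_singular_ode (m : ℕ) {S : Set ℝ}
    (hS : ∀ t ∈ S, ∀ θ ∈ Ioc (0 : ℝ) 1, θ * t ∈ S) {y : ℝ → ℂ} {y0 : ℂ} {g : ℝ → ℂ} {M t : ℝ}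
    (hy : Tendsto y (𝓝[S] 0) (𝓝 y0)) (ht : t ∈ S)
    (hode : ∀ s ∈ S, |s| ≤ |t| → ∃ d : ℂ, HasDerivAt y d s ∧
      s * d = -m * (y s - y0) + s * g s)
    (hg : ContinuousOn g {s ∈ S | |s| ≤ |t|}) (hM : ∀ s ∈ S, |s| ≤ |t| → ‖g s‖ ≤ M) :
    y t = y0 + t * ∫ θ in (0 : ℝ)..1, (θ : ℂ) ^ m * g (θ * t) := by
  have habs : ∀ θ ∈ Ioc (0 : ℝ) 1, |θ * t| ≤ |t| := by
    intro θ hθ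
    rw [abs_mul, abs_of_pos hθ.1]
    nlinarith [hθ.2, abs_nonneg t]
  have hderiv : ∀ θ ∈ Ioc (0 : ℝ) 1,
      HasDerivAt (fun θ : ℝ => (θ : ℂ) ^ m * (y (θ * t) - y0)) (t * ((θ : ℂ) ^ m * g (θ * t))) θ := by
    intro θ hθ
    obtain ⟨d, hd, hd'⟩ := hode _ (hS t ht θ hθ) (habs θ hθ)
    have h1 : HasDerivAt (fun θ : ℝ => (θ : ℂ) ^ m) (m * (θ : ℂ) ^ (m - 1)) θ := by
      simpa using (hasDerivAt_pow m (θ : ℂ)).comp_ofReal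
    have h2 : HasDerivAt (fun θ : ℝ => y (θ * t)) (t • d) θ := by
      have h3 : HasDerivAt (fun θ : ℝ => θ * t) t θ := by
        simpa using (hasDerivAt_id θ).mul_const t
      exact HasDerivAt.scomp θ hd h3
    refine (h1.mul (h2.sub_const y0)).congr_deriv ?_
    have hθ0 : (θ : ℂ) ≠ 0 := by exact_mod_cast hθ.1.ne'
    apply mul_left_cancel₀ hθ0
    have h5 : (θ : ℂ) * (m * (θ : ℂ) ^ (m - 1)) = m * (θ : ℂ) ^ m := by
      rcases m with _ | m
      · simp
      · simp [pow_succ]; ring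
    push_cast at hd'
    rw [Complex.real_smul]
    linear_combination (y (θ * t) - y0) * h5 + (θ : ℂ) ^ m * hd'
  have hmaps : MapsTo (fun θ : ℝ => θ * t) (Ioc 0 1) {s ∈ S | |s| ≤ |t|} :=
    fun θ hθ => ⟨hS t ht θ hθ, habs θ hθ⟩
  have hint := intervalIntegrable_pow_mul m (a := fun θ => g (θ * t)) (C := M)
    (hg.comp (by fun_prop) hmaps) fun θ hθ => hM _ (hS t ht θ hθ) (habs θ hθ)
  have h0 : Tendsto (fun θ : ℝ => (θ : ℂ) ^ m * (y (θ * t) - y0)) (𝓝[>] 0) (𝓝 0) := by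
    have h1 : Tendsto (fun θ : ℝ => θ * t) (𝓝[>] 0) (𝓝[S] 0) := by
      refine tendsto_nhdsWithin_iff.2 ⟨?_, ?_⟩
      · have : Tendsto (fun θ : ℝ => θ * t) (𝓝 0) (𝓝 (0 * t)) := by
          apply Continuous.tendsto; fun_prop
        rw [zero_mul] at this
        exact this.mono_left nhdsWithin_le_nhds
      · filter_upwards [Ioc_mem_nhdsGT (zero_lt_one' ℝ)] with θ hθ using hS t ht θ hθ
    have h2 : Tendsto (fun θ : ℝ => (θ : ℂ) ^ m) (𝓝[>] 0) (𝓝 ((0 : ℝ) ^ m)) := by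
      have : Continuous (fun θ : ℝ => (θ : ℂ) ^ m) := by fun_prop
      simpa using (this.tendsto 0).mono_left nhdsWithin_le_nhds
    simpa using h2.mul ((hy.comp h1).sub_const y0)
  have h1 : Tendsto (fun θ : ℝ => (θ : ℂ) ^ m * (y (θ * t) - y0)) (𝓝[<] 1) (𝓝 (y t - y0)) := by
    have := (hderiv 1 (by simp)).continuousAt.tendsto
    simpa using this.mono_left nhdsWithin_le_nhds
  have := intervalIntegral.integral_eq_sub_of_hasDerivAt_of_tendsto zero_lt_one
    (fun θ hθ => hderiv θ (Ioo_subset_Ioc_self hθ)) (hint.const_mul (t : ℂ)) h0 h1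
  rw [intervalIntegral.integral_const_mul] at this
  rw [this]
  ring

theorem exists_analyticAt_of_singular_ode {n : ℕ} (lam : Fin n → ℕ)
    (G : ℂ × (Fin n → ℂ) → Fin n → ℂ) (u0 : Fin n → ℂ) (hG : AnalyticAt ℂ G (0, u0))
    {S : Set ℝ} (hS : ∀ t ∈ S, ∀ θ ∈ Ioc (0 : ℝ) 1, θ * t ∈ S) (u : ℝ → Fin n → ℂ)
    (hu : Tendsto u (𝓝[S] 0) (𝓝 u0))
    (hode : ∀ᶠ t in 𝓝[S] (0 : ℝ), ∀ i, ∃ d : ℂ, HasDerivAt (fun s => u s i) d t ∧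
      t * d = -lam i * (u t i - u0 i) + t * G (t, u t) i) :
    ∃ v : ℂ → Fin n → ℂ, AnalyticAt ℂ v 0 ∧ ∀ᶠ t : ℝ in 𝓝[S] 0, v t = u t := by
  obtain ⟨K, s, hs, hK⟩ := (hG.contDiffAt (n := 1)).exists_lipschitzOnWith
  set M : ℝ := ‖G (0, u0)‖ + 1 with hMdef
  have hMpos : 0 < M := by positivity
  have hbd : ∀ᶠ x in 𝓝 ((0 : ℂ), u0), ‖G x‖ < M :=
    hG.continuousAt.norm.eventually (gt_mem_nhds (lt_add_one _))
  obtain ⟨R, hR, hball⟩ := Metric.eventually_nhds_iff_ball.1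
    ((hG.eventually_analyticAt.and hbd).and hs)
  have hGd : DifferentiableOn ℂ G (Metric.ball (0, u0) R) := fun x hx =>
    (hball x hx).1.1.differentiableAt.differentiableWithinAt
  have hGM : ∀ x ∈ Metric.ball ((0 : ℂ), u0) R, ‖G x‖ ≤ M := fun x hx => (hball x hx).1.2.le
  have hGK : ∀ x ∈ Metric.ball ((0 : ℂ), u0) R, ∀ y ∈ Metric.ball ((0 : ℂ), u0) R,
      ‖G x - G y‖ ≤ K * ‖x - y‖ := fun x hx y hy =>
    hK.norm_sub_le (hball x hx).2 (hball y hy).2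
  clear hball hbd hK hs
  obtain ⟨r, hr, hrR, hrM, hrK⟩ : ∃ r : ℝ, 0 < r ∧ r ≤ R ∧ r * M ≤ R / 2 ∧ r * K ≤ 1 / 2 := by
    refine ⟨min R (min (R / (2 * M)) (1 / (2 * (K + 1)))), by positivity, min_le_left _ _, ?_, ?_⟩
    · calc _ ≤ R / (2 * M) * M := by
            gcongr
            exact (min_le_right _ _).trans (min_le_left _ _)
        _ = R / 2 := by field_simp
    · calc _ ≤ 1 / (2 * ((K : ℝ) + 1)) * K := by
            gcongr
            exact (min_le_right _ _).trans (min_le_right _ _)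
        _ ≤ 1 / (2 * ((K : ℝ) + 1)) * (K + 1) := by gcongr; linarith
        _ = 1 / 2 := by field_simp
  have hin : ∀ z : ℂ, ‖z‖ < r → ∀ x : Fin n → ℂ, ‖x - u0‖ ≤ R / 2 →
      (z, x) ∈ Metric.ball ((0 : ℂ), u0) R := by
    intro z hz x hx
    rw [mem_ball_iff_norm, Prod.norm_def]
    refine max_lt ?_ ?_
    · simpa using hz.trans_le hrR
    · exact hx.trans_lt (half_lt_self hR)
  have hscale : ∀ z : ℂ, ‖z‖ < r → ∀ θ ∈ Icc (0 : ℝ) 1, ‖(θ : ℂ) * z‖ < r := by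
    intro z hz θ hθ
    simp only [norm_mul, Complex.norm_real, Real.norm_eq_abs, abs_of_nonneg hθ.1]
    nlinarith [hθ.2, norm_nonneg z]
  -- bounds for the integral operator along a ray
  have hbound : ∀ z : ℂ, ‖z‖ < r → ∀ a : ℝ → Fin n → ℂ,
      (∀ θ ∈ Ioc (0 : ℝ) 1, ‖a θ - u0‖ ≤ R / 2) → ∀ i,
      ‖z * ∫ θ in (0 : ℝ)..1, (θ : ℂ) ^ lam i * G (θ * z, a θ) i‖ ≤ R / 2 := by
    intro z hz a ha i
    rw [norm_mul]
    refine le_trans ?_ hrM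
    gcongr
    exact norm_integral_pow_mul_le _ fun θ hθ => (norm_le_pi_norm _ i).trans
      (hGM _ (hin _ (hscale z hz θ (Ioc_subset_Icc_self hθ)) _ (ha θ hθ)))
  have hint : ∀ z : ℂ, ‖z‖ < r → ∀ a : ℝ → Fin n → ℂ, ContinuousOn a (Ioc 0 1) →
      (∀ θ ∈ Ioc (0 : ℝ) 1, ‖a θ - u0‖ ≤ R / 2) → ∀ i,
      IntervalIntegrable (fun θ : ℝ => (θ : ℂ) ^ lam i * G (θ * z, a θ) i) volume 0 1 := by
    intro z hz a hac ha i
    have hmaps : MapsTo (fun θ : ℝ => ((θ : ℂ) * z, a θ)) (Ioc 0 1) (Metric.ball (0, u0) R) :=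
      fun θ hθ => hin _ (hscale z hz θ (Ioc_subset_Icc_self hθ)) _ (ha θ hθ)
    refine intervalIntegrable_pow_mul (lam i) (a := fun θ : ℝ => G (θ * z, a θ) i) (C := M) ?_ ?_
    · have h1 : ContinuousOn (fun θ : ℝ => G (θ * z, a θ)) (Ioc 0 1) :=
        hGd.continuousOn.comp (ContinuousOn.prodMk (by fun_prop) hac) hmaps
      exact (continuous_apply i).comp_continuousOn h1
    · exact fun θ hθ => (norm_le_pi_norm _ i).trans (hGM _ (hmaps hθ))
  have hdiff : ∀ z : ℂ, ‖z‖ < r → ∀ a b : ℝ → Fin n → ℂ, ∀ C : ℝ,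
      ContinuousOn a (Ioc 0 1) → ContinuousOn b (Ioc 0 1) →
      (∀ θ ∈ Ioc (0 : ℝ) 1, ‖a θ - u0‖ ≤ R / 2) → (∀ θ ∈ Ioc (0 : ℝ) 1, ‖b θ - u0‖ ≤ R / 2) →
      (∀ θ ∈ Ioc (0 : ℝ) 1, ‖a θ - b θ‖ ≤ C) → ∀ i,
      ‖z * (∫ θ in (0 : ℝ)..1, (θ : ℂ) ^ lam i * G (θ * z, a θ) i)
        - z * ∫ θ in (0 : ℝ)..1, (θ : ℂ) ^ lam i * G (θ * z, b θ) i‖ ≤ C / 2 := by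
    intro z hz a b C hac hbc ha hb hab i
    have hC : 0 ≤ C := (norm_nonneg _).trans (hab 1 (by simp))
    rw [← mul_sub, ← intervalIntegral.integral_sub (hint z hz a hac ha i) (hint z hz b hbc hb i)]
    simp_rw [← mul_sub]
    rw [norm_mul]
    calc _ ≤ r * (K * C) := by
          gcongr
          refine norm_integral_pow_mul_le _ fun θ hθ => ?_
          have h1 := hscale z hz θ (Ioc_subset_Icc_self hθ)
          have h2 := hGK _ (hin _ h1 _ (ha θ hθ)) _ (hin _ h1 _ (hb θ hθ))
          rw [← Pi.sub_apply]
          refine (norm_le_pi_norm _ i).trans (h2.trans ?_)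
          gcongr
          rw [Prod.mk_sub_mk, sub_self, Prod.norm_def]
          simpa [hC] using hab θ hθ
      _ = (r * K) * C := by ring
      _ ≤ 1 / 2 * C := by gcongr
      _ = C / 2 := by ring
  -- Picard iterates
  let v : ℕ → ℂ → Fin n → ℂ := fun k => Nat.rec (fun _ => u0)
    (fun _ w z i => u0 i + z * ∫ θ in (0 : ℝ)..1, (θ : ℂ) ^ lam i * G (θ * z, w (θ * z)) i) k
  have hv0 : ∀ z, v 0 z = u0 := fun z => rfl
  have hvs : ∀ k z i, v (k + 1) z i =
    u0 i + z * ∫ θ in (0 : ℝ)..1, (θ : ℂ) ^ lam i * G (θ * z, v k (θ * z)) i := fun _ _ _ => rfl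
  clear_value v
  have hinv : ∀ k, DifferentiableOn ℂ (v k) (Metric.ball 0 r) ∧
      ∀ z : ℂ, ‖z‖ < r → ‖v k z - u0‖ ≤ R / 2 := by
    intro k
    induction k with
    | zero =>
      have : v 0 = fun _ => u0 := funext hv0
      rw [this]
      exact ⟨differentiableOn_const _, fun z _ => by simp; positivity⟩
    | succ k ih =>
      refine ⟨?_, ?_⟩
      · rw [differentiableOn_pi]
        intro i
        simp_rw [hvs]
        refine (differentiableOn_id.mul
          (differentiableOn_integral_pow_mul_comp_smul (lam i)
            (f := fun z => G (z, v k z) i) ?_)).const_add (u0 i)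
        have h1 : DifferentiableOn ℂ (fun z => G (z, v k z)) (Metric.ball 0 r) :=
          hGd.comp (differentiableOn_id.prodMk ih.1)
            fun z hz => hin z (by simpa using hz) _ (ih.2 z (by simpa using hz))
        exact differentiableOn_pi.1 h1 i
      · intro z hz
        rw [pi_norm_le_iff_of_nonneg (by positivity)]
        intro i
        rw [Pi.sub_apply, hvs, add_sub_cancel_left]
        exact hbound z hz (fun θ => v k (θ * z))
          (fun θ hθ => ih.2 _ (hscale z hz θ (Ioc_subset_Icc_self hθ))) i
  have hray : ∀ k, ∀ z : ℂ, ‖z‖ < r → ContinuousOn (fun θ : ℝ => v k (θ * z)) (Ioc 0 1) :=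
    fun k z hz => (hinv k).1.continuousOn.comp (by fun_prop)
      fun θ hθ => by simpa using hscale z hz θ (Ioc_subset_Icc_self hθ)
  have hstep : ∀ k, ∀ z : ℂ, ‖z‖ < r → ‖v k z - v (k + 1) z‖ ≤ R / 2 / 2 ^ k := by
    intro k
    induction k with
    | zero =>
      intro z hz
      rw [hv0, norm_sub_rev]
      simpa using (hinv 1).2 z hz
    | succ k ih =>
      intro z hz
      rw [pi_norm_le_iff_of_nonneg (by positivity)]
      intro i
      rw [Pi.sub_apply, hvs, hvs, add_sub_add_left_eq_sub]
      refine (hdiff z hz _ _ (R / 2 / 2 ^ k) (hray k z hz) (hray (k + 1) z hz)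
        (fun θ hθ => (hinv k).2 _ (hscale z hz θ (Ioc_subset_Icc_self hθ)))
        (fun θ hθ => (hinv (k + 1)).2 _ (hscale z hz θ (Ioc_subset_Icc_self hθ)))
        (fun θ hθ => ih _ (hscale z hz θ (Ioc_subset_Icc_self hθ))) i).trans_eq ?_
      rw [pow_succ]; ring
  -- the limit
  have hlim : ∀ z : ℂ, ∃ L, ‖z‖ < r → Tendsto (fun k => v k z) atTop (𝓝 L) := by
    intro z
    by_cases hz : ‖z‖ < r
    · obtain ⟨L, hL⟩ := cauchySeq_tendsto_of_complete
        (cauchySeq_of_le_geometric_two (C := R) (f := fun k => v k z)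
          fun k => by rw [dist_eq_norm]; exact hstep k z hz)
      exact ⟨L, fun _ => hL⟩
    · exact ⟨0, fun h => absurd h hz⟩
  choose w hw using hlim
  have hunif : TendstoUniformlyOn v w atTop (Metric.ball 0 r) := by
    rw [Metric.tendstoUniformlyOn_iff]
    intro ε hε
    have h1 : Tendsto (fun k : ℕ => R / 2 ^ k) atTop (𝓝 0) := by
      have := (tendsto_pow_atTop_nhds_zero_of_lt_one (r := (1 / 2 : ℝ)) (by norm_num)
        (by norm_num)).const_mul R
      simpa [div_eq_mul_inv] using this
    filter_upwards [h1.eventually (gt_mem_nhds hε)] with k hk z hz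
    have hz' : ‖z‖ < r := by simpa using hz
    rw [dist_comm]
    refine lt_of_le_of_lt ?_ hk
    exact dist_le_of_le_geometric_two_of_tendsto (C := R) (f := fun k => v k z)
      (fun k => by rw [dist_eq_norm]; exact hstep k z hz') (hw z hz') k
  have hwd : DifferentiableOn ℂ w (Metric.ball 0 r) :=
    hunif.tendstoLocallyUniformlyOn.differentiableOn
      (Eventually.of_forall fun k => (hinv k).1) Metric.isOpen_ball
  refine ⟨w, hwd.analyticAt (Metric.ball_mem_nhds 0 hr), ?_⟩
  -- the limit agrees with the given solution
  have hu' : ∀ᶠ t in 𝓝[S] (0 : ℝ), ‖u t - u0‖ ≤ R / 2 := by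
    have : Tendsto (fun t => ‖u t - u0‖) (𝓝[S] 0) (𝓝 0) := by
      simpa using (hu.sub_const u0).norm
    exact this.eventually (ge_mem_nhds (by positivity))
  obtain ⟨δ, hδ, hδS⟩ := Metric.mem_nhdsWithin_iff.1 (hu'.and hode)
  have hloc : ∀ t ∈ S, |t| < δ → ‖u t - u0‖ ≤ R / 2 ∧
      ∀ i, ∃ d : ℂ, HasDerivAt (fun s => u s i) d t ∧
        t * d = -lam i * (u t i - u0 i) + t * G (t, u t) i :=
    fun t ht htδ => hδS ⟨by simpa using htδ, ht⟩
  have hucont : ∀ t ∈ S, |t| < δ → ContinuousAt u t := fun t ht htδ =>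
    continuousAt_pi.2 fun i => by
      obtain ⟨d, hd, -⟩ := (hloc t ht htδ).2 i
      exact hd.continuousAt
  have hueq : ∀ t ∈ S, |t| < δ → |t| < r → ∀ i, u t i =
      u0 i + t * ∫ θ in (0 : ℝ)..1, (θ : ℂ) ^ lam i * G (θ * t, u (θ * t)) i := by
    intro t ht htδ htr i
    have hmem : ∀ s ∈ S, |s| ≤ |t| → ((s : ℂ), u s) ∈ Metric.ball ((0 : ℂ), u0) R :=
      fun s hs hst => hin _ (by simpa using hst.trans_lt htr) _ (hloc s hs (hst.trans_lt htδ)).1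
    have := integral_eq_of_singular_ode (lam i) hS (y := fun s => u s i) (y0 := u0 i)
      (g := fun s => G (s, u s) i) (M := M) (t := t)
      (((continuous_apply i).tendsto u0).comp hu) ht
      (fun s hs hst => (hloc s hs (hst.trans_lt htδ)).2 i) ?_
      (fun s hs hst => (norm_le_pi_norm _ i).trans (hGM _ (hmem s hs hst)))
    · simpa using this
    · have h1 : ContinuousOn (fun s : ℝ => G (s, u s)) {s ∈ S | |s| ≤ |t|} :=
        hGd.continuousOn.comp
          (ContinuousOn.prodMk Complex.continuous_ofReal.continuousOn
            fun s hs => (hucont s hs.1 (hs.2.trans_lt htδ)).continuousWithinAt)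
          fun s hs => hmem s hs.1 hs.2
      exact (continuous_apply i).comp_continuousOn h1
  have habs : ∀ t : ℝ, ∀ θ ∈ Ioc (0 : ℝ) 1, |θ * t| ≤ |t| := by
    intro t θ hθ
    rw [abs_mul, abs_of_pos hθ.1]
    nlinarith [hθ.2, abs_nonneg t]
  have hclose : ∀ k, ∀ t ∈ S, |t| < δ → |t| < r → ‖v k t - u t‖ ≤ R / 2 / 2 ^ k := by
    intro k
    induction k with
    | zero =>
      intro t ht htδ htr
      rw [hv0, norm_sub_rev]
      simpa using (hloc t ht htδ).1
    | succ k ih =>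
      intro t ht htδ htr
      have htr' : ‖(t : ℂ)‖ < r := by simpa using htr
      rw [pi_norm_le_iff_of_nonneg (by positivity)]
      intro i
      rw [Pi.sub_apply, hvs, hueq t ht htδ htr, add_sub_add_left_eq_sub]
      refine (hdiff t htr' _ (fun θ : ℝ => u (θ * t)) (R / 2 / 2 ^ k) (hray k t htr') ?_
        (fun θ hθ => (hinv k).2 _ (hscale t htr' θ (Ioc_subset_Icc_self hθ)))
        (fun θ hθ => (hloc _ (hS t ht θ hθ) ((habs t θ hθ).trans_lt htδ)).1)
        (fun θ hθ => ?_) i).trans_eq ?_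
      · intro θ hθ
        refine ContinuousAt.continuousWithinAt ?_
        exact ContinuousAt.comp (f := fun θ : ℝ => θ * t)
          (hucont _ (hS t ht θ hθ) ((habs t θ hθ).trans_lt htδ)) (by fun_prop)
      · have := ih _ (hS t ht θ hθ) ((habs t θ hθ).trans_lt htδ) ((habs t θ hθ).trans_lt htr)
        simpa using this
      · rw [pow_succ]; ring
  have hmin : Metric.ball (0 : ℝ) (min δ r) ∩ S ∈ 𝓝[S] (0 : ℝ) :=
    inter_mem (mem_nhdsWithin_of_mem_nhds (Metric.ball_mem_nhds _ (lt_min hδ hr)))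
      self_mem_nhdsWithin
  filter_upwards [hmin] with t ht
  have ht1 : |t| < min δ r := by simpa using ht.1
  have htδ := ht1.trans_le (min_le_left _ _)
  have htr := ht1.trans_le (min_le_right _ _)
  refine tendsto_nhds_unique (hw t (by simpa using htr)) ?_
  rw [tendsto_iff_norm_sub_tendsto_zero]
  refine squeeze_zero (fun _ => norm_nonneg _) (fun k => hclose k t ht.2 htδ htr) ?_
  have := (tendsto_pow_atTop_nhds_zero_of_lt_one (r := (1 / 2 : ℝ)) (by norm_num)
    (by norm_num)).const_mul (R / 2)
  simpa [div_eq_mul_inv] using this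

theorem exists_real_analyticAt_of_singular_ode {n : ℕ} (lam : Fin n → ℕ)
    (G : ℂ × (Fin n → ℂ) → Fin n → ℂ) (u0 : Fin n → ℝ)
    (hG : AnalyticAt ℂ G (0, fun i => (u0 i : ℂ)))
    {S : Set ℝ} (hS : ∀ t ∈ S, ∀ θ ∈ Ioc (0 : ℝ) 1, θ * t ∈ S) (u : Fin n → ℝ → ℝ)
    (hu : ∀ i, Tendsto (u i) (𝓝[S] 0) (𝓝 (u0 i)))
    (hode : ∀ i, ∀ᶠ t in 𝓝[S] (0 : ℝ), ∃ d : ℝ, HasDerivAt (u i) d t ∧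
      (t : ℂ) * d = -lam i * (u i t - u0 i) + t * G (t, fun j => (u j t : ℂ)) i) (i : Fin n) :
    ∃ g : ℝ → ℝ, AnalyticAt ℝ g 0 ∧ ∀ᶠ t in 𝓝[S] 0, u i t = g t := by
  obtain ⟨v, hv, hvu⟩ := exists_analyticAt_of_singular_ode lam G (fun i => (u0 i : ℂ)) hG hS
    (fun t j => (u j t : ℂ))
    (tendsto_pi_nhds.2 fun j => (Complex.continuous_ofReal.tendsto _).comp (hu j)) (by
      filter_upwards [eventually_all.2 hode] with t ht j
      obtain ⟨d, hd, hd'⟩ := ht j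
      exact ⟨d, hd.ofReal_comp, hd'⟩)
  refine ⟨fun t => (v t i).re, ?_, ?_⟩
  · have h1 : AnalyticAt ℂ (fun z => v z i) ((0 : ℝ) : ℂ) := by
      simpa using analyticAt_pi_iff.1 hv i
    exact h1.re_ofReal
  · filter_upwards [hvu] with t ht
    rw [ht]
    simp

/-- The entire function `z ↦ sin z / z`. -/
def complexSinc : ℂ → ℂ := dslope Complex.sin 0

/-- The entire function `z ↦ (sin z / z - 1) / z`. -/
def complexSincSlope : ℂ → ℂ := dslope complexSinc 0

theorem mul_complexSinc (z : ℂ) : z * complexSinc z = Complex.sin z := by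
  simpa [complexSinc] using sub_smul_dslope Complex.sin 0 z

theorem mul_complexSincSlope (z : ℂ) : z * complexSincSlope z = complexSinc z - 1 := by
  simpa [complexSincSlope, complexSinc, dslope_same] using sub_smul_dslope complexSinc 0 z

theorem differentiable_dslope_zero {f : ℂ → ℂ} (hf : Differentiable ℂ f) :
    Differentiable ℂ (dslope f 0) :=
  differentiableOn_univ.1 ((Complex.differentiableOn_dslope univ_mem).2 hf.differentiableOn)

theorem differentiable_complexSinc : Differentiable ℂ complexSinc :=
  differentiable_dslope_zero Complex.differentiable_sin

@[fun_prop]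
theorem AnalyticAt.complexSin_comp {E : Type*} [NormedAddCommGroup E] [NormedSpace ℂ E]
    {f : E → ℂ} {x : E} (hf : AnalyticAt ℂ f x) :
    AnalyticAt ℂ (fun x => Complex.sin (f x)) x :=
  Complex.analyticAt_sin.comp hf

@[fun_prop]
theorem AnalyticAt.complexSinc_comp {E : Type*} [NormedAddCommGroup E] [NormedSpace ℂ E]
    {f : E → ℂ} {x : E} (hf : AnalyticAt ℂ f x) :
    AnalyticAt ℂ (fun x => complexSinc (f x)) x :=
  (differentiable_complexSinc.analyticAt _).comp hf

@[fun_prop]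
theorem AnalyticAt.complexSincSlope_comp {E : Type*} [NormedAddCommGroup E] [NormedSpace ℂ E]
    {f : E → ℂ} {x : E} (hf : AnalyticAt ℂ f x) :
    AnalyticAt ℂ (fun x => complexSincSlope (f x)) x :=
  ((differentiable_dslope_zero differentiable_complexSinc).analyticAt _).comp hf

@[fun_prop]
theorem analyticAt_fst_prod {E F : Type*} [NormedAddCommGroup E] [NormedSpace ℂ E]
    [NormedAddCommGroup F] [NormedSpace ℂ F] (x : E × F) :
    AnalyticAt ℂ (fun x : E × F => x.1) x :=
  (ContinuousLinearMap.fst ℂ E F).analyticAt x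

theorem analyticAt_snd_apply {n : ℕ} (j : Fin n) (x : ℂ × (Fin n → ℂ)) :
    AnalyticAt ℂ (fun x : ℂ × (Fin n → ℂ) => x.2 j) x :=
  ((ContinuousLinearMap.proj (R := ℂ) (φ := fun _ : Fin n => ℂ) j).comp
    (ContinuousLinearMap.snd ℂ ℂ (Fin n → ℂ))).analyticAt x

theorem IsCOrbit.analyticAt_of_mem_Ioo {α c : ℝ} {H H' A Z : ℝ → ℝ} {ρ₁ : ℝ}
    (horb : IsCOrbit α c H H' A Z ρ₁) {ρ₀ : ℝ} (hρ₀ : ρ₀ ∈ Ioo 0 ρ₁) :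
    AnalyticAt ℝ H ρ₀ ∧ AnalyticAt ℝ H' ρ₀ ∧ AnalyticAt ℝ A ρ₀ ∧ AnalyticAt ℝ Z ρ₀ := by
  have hρ : (ρ₀ : ℂ) ≠ 0 := by exact_mod_cast hρ₀.1.ne'
  have hA : (A ρ₀ : ℂ) ≠ 0 := by exact_mod_cast (horb.hApos _ hρ₀).ne'
  have hZ : (1 - (Z ρ₀ : ℂ) ^ 2) ≠ 0 := by
    have h1 := horb.hZ01 _ hρ₀
    have : 1 - Z ρ₀ ^ 2 ≠ 0 := by nlinarith
    exact_mod_cast this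
  let f : Fin 4 → ℝ → ℝ := ![H, H', A, Z]
  let G : ℂ × (Fin 4 → ℂ) → Fin 4 → ℂ := fun x =>
    ![x.2 1,
      α * (1 + x.2 3 ^ 2) * (ρ₀ + x.1) * x.2 1 ^ 3 - (2 / (ρ₀ + x.1)) * x.2 1
        - Complex.sin (2 * x.2 0) / (x.2 2 * (ρ₀ + x.1) ^ 2 * (1 - x.2 3 ^ 2)),
      -2 * α * (ρ₀ + x.1) * x.2 2 * x.2 1 ^ 2,
      x.2 3 * (1 + α * (1 - x.2 3 ^ 2) * (ρ₀ + x.1) ^ 2 * x.2 1 ^ 2) / (ρ₀ + x.1)]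
  have hpr := fun j => analyticAt_snd_apply (n := 4) j (0, fun j => (f j ρ₀ : ℂ))
  have h0 := hpr 0
  have h1 := hpr 1
  have h2 := hpr 2
  have h3 := hpr 3
  have hf : ∀ j, ∀ ρ ∈ Ioo 0 ρ₁, ∃ d : ℝ, HasDerivAt (f j) d ρ ∧
      (d : ℂ) = G (ρ - ρ₀, fun j => (f j ρ : ℂ)) j := by
    intro j ρ h
    fin_cases j
    · exact ⟨_, horb.hH ρ h, by simp [f, G]⟩
    · exact ⟨_, horb.hH' ρ h, by simp [f, G]⟩
    · exact ⟨_, horb.hA ρ h, by simp [f, G]⟩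
    · exact ⟨_, horb.hZ ρ h, by simp [f, G]⟩
  have hG : AnalyticAt ℂ G (0, fun j => (f j ρ₀ : ℂ)) := by
    rw [analyticAt_pi_iff]
    intro j
    fin_cases j
    · exact h1
    · refine AnalyticAt.sub (by fun_prop (disch := simpa using hρ)) ?_
      refine AnalyticAt.div (by fun_prop) (by fun_prop) ?_
      simp [f, hρ, hA, hZ]
    · simp only [Fin.reduceFinMk, Matrix.cons_val]; fun_prop
    · simp only [Fin.reduceFinMk, Matrix.cons_val]; fun_prop (disch := simpa using hρ)
  have hcont : Tendsto (fun t : ℝ => ρ₀ + t) (𝓝 0) (𝓝 ρ₀) := by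
    simpa using (continuous_const_add ρ₀).tendsto 0
  have key := exists_real_analyticAt_of_singular_ode (fun _ => 0) G (fun j => f j ρ₀) hG
    (S := univ) (by simp) (fun j t => f j (ρ₀ + t)) ?_ ?_
  · have hfan : ∀ j, AnalyticAt ℝ (f j) ρ₀ := by
      intro j
      obtain ⟨g, hg, hgf⟩ := key j
      rw [nhdsWithin_univ] at hgf
      have h1 : AnalyticAt ℝ (fun ρ => g (ρ - ρ₀)) ρ₀ := by
        refine AnalyticAt.fun_comp (by simpa using hg) (by fun_prop)
      refine h1.congr ?_
      have h2 : Tendsto (fun ρ : ℝ => ρ - ρ₀) (𝓝 ρ₀) (𝓝 0) := by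
        simpa using (continuous_sub_right ρ₀).tendsto ρ₀
      filter_upwards [h2.eventually hgf] with ρ h
      rw [← h]; simp
    exact ⟨hfan 0, hfan 1, hfan 2, hfan 3⟩
  · intro j
    rw [nhdsWithin_univ]
    obtain ⟨d, hd, -⟩ := hf j ρ₀ hρ₀
    exact hd.continuousAt.tendsto.comp hcont
  · intro j
    rw [nhdsWithin_univ]
    filter_upwards [hcont.eventually (isOpen_Ioo.mem_nhds hρ₀)] with t ht
    obtain ⟨d, hd, hd'⟩ := hf j _ ht
    refine ⟨d, hd.comp_const_add ρ₀ t, ?_⟩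
    rw [hd']
    push_cast
    simp

theorem center_ode_identity {α t p q a z s S pd : ℂ} (ht : t ≠ 0) (ha : 1 + t * a ≠ 0)
    (hz : 1 - (t * z) ^ 2 ≠ 0) (hs : s = -(2 * t * q * (1 + 2 * t * q * S)))
    (hpd : pd = α * (1 + (t * z) ^ 2) * t * p ^ 3 - (2 / t) * p
      - s / ((1 + t * a) * t ^ 2 * (1 - (t * z) ^ 2))) :
    t * pd = -2 * p + 2 * q + t * (α * t * (1 + (t * z) ^ 2) * p ^ 3
      + 2 * q * (2 * q * S - a + t * z ^ 2 + t ^ 2 * a * z ^ 2)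
        / ((1 + t * a) * (1 - (t * z) ^ 2))) := by
  subst hs hpd
  rw [mul_pow] at hz ⊢
  field_simp
  ring

theorem IsCOrbit.exists_analyticAt_zero {α c : ℝ} {H H' A Z : ℝ → ℝ} {ρ₁ : ℝ}
    (horb : IsCOrbit α c H H' A Z ρ₁) :
    (∃ g : ℝ → ℝ, AnalyticAt ℝ g 0 ∧ ∀ᶠ ρ in 𝓝[>] 0, H ρ = g ρ) ∧
    (∃ g : ℝ → ℝ, AnalyticAt ℝ g 0 ∧ ∀ᶠ ρ in 𝓝[>] 0, H' ρ = g ρ) ∧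
    (∃ g : ℝ → ℝ, AnalyticAt ℝ g 0 ∧ ∀ᶠ ρ in 𝓝[>] 0, A ρ = g ρ) ∧
    ∃ g : ℝ → ℝ, AnalyticAt ℝ g 0 ∧ ∀ᶠ ρ in 𝓝[>] 0, Z ρ = g ρ := by
  have hIoo : ∀ᶠ t in 𝓝[>] (0 : ℝ), t ∈ Ioo 0 ρ₁ := Ioo_mem_nhdsGT horb.rho1_pos
  have hid : Tendsto (fun t : ℝ => t) (𝓝[>] 0) (𝓝 0) := nhdsWithin_le_nhds
  have hq : Tendsto (fun t => (H t + π / 2) / t) (𝓝[>] 0) (𝓝 c) := by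
    refine HasDerivAt.lhopital_zero_nhdsGT (f' := H') (g' := fun _ => 1) ?_
      (Eventually.of_forall fun t => hasDerivAt_id t) (by simp) ?_ hid ?_
    · filter_upwards [hIoo] with t ht using (horb.hH t ht).add_const _
    · simpa using horb.Hcont.add_const (π / 2)
    · simpa using horb.H'init
  have hA' : Tendsto (fun t => -2 * α * t * A t * H' t ^ 2) (𝓝[>] 0) (𝓝 0) := by
    simpa using ((hid.const_mul (-2 * α)).mul horb.Acont).mul (horb.H'init.pow 2)
  have ha : Tendsto (fun t => (A t - 1) / t) (𝓝[>] 0) (𝓝 0) := by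
    refine HasDerivAt.lhopital_zero_nhdsGT (f' := fun t => -2 * α * t * A t * H' t ^ 2)
      (g' := fun _ => 1) ?_
      (Eventually.of_forall fun t => hasDerivAt_id t) (by simp) ?_ hid ?_
    · filter_upwards [hIoo] with t ht using (horb.hA t ht).sub_const _
    · simpa using horb.Acont.sub_const 1
    · simpa using hA'
  let f : Fin 4 → ℝ → ℝ := ![fun t => H' t - (H t + π / 2) / t,
    fun t => H' t + 2 * ((H t + π / 2) / t), fun t => (A t - 1) / t, fun t => Z t / t]
  let u0 : Fin 4 → ℝ := ![0, 3 * c, 0, 1]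
  let p : ℂ × (Fin 4 → ℂ) → ℂ := fun x => (x.2 1 + 2 * x.2 0) / 3
  let q : ℂ × (Fin 4 → ℂ) → ℂ := fun x => (x.2 1 - x.2 0) / 3
  let P : ℂ × (Fin 4 → ℂ) → ℂ := fun x =>
    α * x.1 * (1 + (x.1 * x.2 3) ^ 2) * p x ^ 3
      + 2 * q x * (2 * q x * complexSincSlope (2 * x.1 * q x) - x.2 2 + x.1 * x.2 3 ^ 2
          + x.1 ^ 2 * x.2 2 * x.2 3 ^ 2)
        / ((1 + x.1 * x.2 2) * (1 - (x.1 * x.2 3) ^ 2))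
  let G : ℂ × (Fin 4 → ℂ) → Fin 4 → ℂ := fun x =>
    ![P x, P x, -2 * α * (1 + x.1 * x.2 2) * p x ^ 2,
      α * x.1 * p x ^ 2 * (1 - (x.1 * x.2 3) ^ 2) * x.2 3]
  have hpr := fun j => analyticAt_snd_apply (n := 4) j (0, fun j => (u0 j : ℂ))
  have h0 := hpr 0
  have h1 := hpr 1
  have h2 := hpr 2
  have h3 := hpr 3
  have hp : AnalyticAt ℂ p (0, fun j => (u0 j : ℂ)) := by
    simp only [p]; fun_prop (disch := norm_num)
  have hq' : AnalyticAt ℂ q (0, fun j => (u0 j : ℂ)) := by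
    simp only [q]; fun_prop (disch := norm_num)
  have hP : AnalyticAt ℂ P (0, fun j => (u0 j : ℂ)) := by
    simp only [P]
    refine AnalyticAt.add (by fun_prop) (AnalyticAt.div (by fun_prop) (by fun_prop) ?_)
    simp
  have hG : AnalyticAt ℂ G (0, fun j => (u0 j : ℂ)) := by
    rw [analyticAt_pi_iff]
    intro j
    fin_cases j
    · exact hP
    · exact hP
    · simp only [Fin.reduceFinMk, Matrix.cons_val]; fun_prop
    · simp only [Fin.reduceFinMk, Matrix.cons_val]; fun_prop
  have key := exists_real_analyticAt_of_singular_ode ![3, 0, 1, 0] G u0 hG (S := Ioi 0)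
    (fun t ht θ hθ => mul_pos hθ.1 ht) f ?_ ?_
  · obtain ⟨g0, hg0, e0⟩ := key 0
    obtain ⟨g1, hg1, e1⟩ := key 1
    obtain ⟨g2, hg2, e2⟩ := key 2
    obtain ⟨g3, hg3, e3⟩ := key 3
    refine ⟨⟨fun t => t * ((g1 t - g0 t) / 3) - π / 2, by fun_prop (disch := norm_num), ?_⟩,
      ⟨fun t => (g1 t + 2 * g0 t) / 3, by fun_prop (disch := norm_num), ?_⟩,
      ⟨fun t => 1 + t * g2 t, by fun_prop, ?_⟩, ⟨fun t => t * g3 t, by fun_prop, ?_⟩⟩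
    · filter_upwards [e0, e1, hIoo] with t e0 e1 ht
      have := ht.1.ne'
      rw [← e0, ← e1]
      simp only [f, Matrix.cons_val]
      field_simp
      ring
    · filter_upwards [e0, e1, hIoo] with t e0 e1 ht
      rw [← e0, ← e1]
      simp only [f, Matrix.cons_val]
      ring
    · filter_upwards [e2, hIoo] with t e2 ht
      have := ht.1.ne'
      rw [← e2]
      simp only [f, Matrix.cons_val]
      field_simp
      ring
    · filter_upwards [e3, hIoo] with t e3 ht
      have := ht.1.ne'
      rw [← e3]
      simp only [f, Matrix.cons_val]
      field_simp
  · intro j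
    fin_cases j
    · simpa [f, u0] using horb.H'init.sub hq
    · have := horb.H'init.add (hq.const_mul 2)
      rw [show c + 2 * c = 3 * c by ring] at this
      simpa [f, u0] using this
    · simpa [f, u0] using ha
    · simpa [f, u0] using horb.Z'init
  · have hmain : ∀ t ∈ Ioo 0 ρ₁, ∃ pd qd : ℝ, HasDerivAt H' pd t ∧
        HasDerivAt (fun t => (H t + π / 2) / t) qd t ∧
        (t : ℂ) * pd = -2 * H' t + 2 * (((H t + π / 2) / t : ℝ) : ℂ)
          + t * P (t, fun j => (f j t : ℂ)) ∧
        (t : ℂ) * qd = H' t - (((H t + π / 2) / t : ℝ) : ℂ) := by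
      intro t ht
      have ht0 := ht.1.ne'
      have htc : (t : ℂ) ≠ 0 := by exact_mod_cast ht0
      refine ⟨_, _, horb.hH' t ht, ((horb.hH t ht).add_const (π / 2)).div (hasDerivAt_id t) ht0,
        ?_, ?_⟩
      · set Q : ℝ := (H t + π / 2) / t with hQ
        have hp' : p (t, fun j => (f j t : ℂ)) = H' t := by
          simp [p, f]; ring
        have hq' : q (t, fun j => (f j t : ℂ)) = Q := by
          simp [q, f, hQ]; ring
        have hAt : (1 : ℂ) + t * (((A t - 1) / t : ℝ) : ℂ) = A t := by
          push_cast; field_simp; ring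
        have hZt : (t : ℂ) * ((Z t / t : ℝ) : ℂ) = Z t := by
          push_cast; field_simp
        have hAne : (A t : ℂ) ≠ 0 := by exact_mod_cast (horb.hApos _ ht).ne'
        have hZne : (1 - (Z t : ℂ) ^ 2) ≠ 0 := by
          have h1 := horb.hZ01 _ ht
          have : 1 - Z t ^ 2 ≠ 0 := by nlinarith
          exact_mod_cast this
        have := center_ode_identity (α := α) (t := t) (p := H' t) (q := Q)
          (a := (((A t - 1) / t : ℝ) : ℂ)) (z := ((Z t / t : ℝ) : ℂ))
          (s := Complex.sin (2 * H t)) (S := complexSincSlope (2 * t * Q))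
          htc (by rwa [hAt]) (by rwa [hZt]) ?_ rfl
        · simp only [P]
          rw [hp', hq']
          simp only [f, Matrix.cons_val]
          rw [← this, hAt, hZt]
          push_cast
          rfl
        · rw [mul_complexSincSlope, add_sub_cancel, mul_complexSinc]
          have : (2 : ℂ) * H t = 2 * t * Q - π := by
            have h : H t = t * Q - π / 2 := by rw [hQ]; field_simp; ring
            rw [h]; push_cast; ring
          rw [this, Complex.sin_sub_pi]
      · push_cast
        field_simp
    have hev : ∀ j, ∀ t ∈ Ioo 0 ρ₁, ∃ d : ℝ, HasDerivAt (f j) d t ∧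
        (t : ℂ) * d = -(![3, 0, 1, 0] : Fin 4 → ℕ) j * (f j t - u0 j)
          + t * G (t, fun j => (f j t : ℂ)) j := by
      intro j t ht
      have ht0 := ht.1.ne'
      have htc : (t : ℂ) ≠ 0 := by exact_mod_cast ht0
      obtain ⟨pd, qd, hpd, hqd, epd, eqd⟩ := hmain t ht
      have hp' : p (t, fun j => (f j t : ℂ)) = H' t := by
        simp [p, f]; ring
      fin_cases j
      · refine ⟨_, hpd.sub hqd, ?_⟩
        simp only [G, Fin.mk_zero, Matrix.cons_val, u0]
        push_cast at *
        simp only [f, Matrix.cons_val]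
        push_cast
        linear_combination epd - eqd
      · refine ⟨_, hpd.add (hqd.const_mul 2), ?_⟩
        simp only [G, Fin.mk_one, Matrix.cons_val, u0]
        push_cast at *
        linear_combination epd + 2 * eqd
      · refine ⟨_, ((horb.hA t ht).sub_const 1).div (hasDerivAt_id t) ht0, ?_⟩
        simp only [G, Fin.reduceFinMk, Matrix.cons_val, u0, hp']
        simp only [f, Matrix.cons_val]
        push_cast
        field_simp
        ring
      · refine ⟨_, (horb.hZ t ht).div (hasDerivAt_id t) ht0, ?_⟩
        simp only [G, Fin.reduceFinMk, Matrix.cons_val, u0, hp']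
        simp only [f, Matrix.cons_val]
        push_cast
        field_simp
        ring
    intro j
    filter_upwards [hIoo] with t ht using hev j t ht

theorem cone_ode_identity_Z {α ρ₁ t p v Zd : ℂ} (hρ₁ : ρ₁ ≠ 0) (hρ : ρ₁ - t ≠ 0)
    (hZd : Zd = (1 - t * v) * (1 + α * (1 - (1 - t * v) ^ 2) * (ρ₁ - t) ^ 2 * p ^ 2) / (ρ₁ - t)) :
    Zd = 1 / ρ₁ + t * ((ρ₁ * (-v * (1 + α * t * v * (2 - t * v) * (ρ₁ - t) ^ 2 * p ^ 2)
      + α * v * (2 - t * v) * (ρ₁ - t) ^ 2 * p ^ 2) + 1) / ((ρ₁ - t) * ρ₁)) := by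
  subst hZd
  field_simp
  ring

theorem cone_ode_identity_H {α ρ t p q v A s S pd : ℂ} (ht : t ≠ 0) (hρ : ρ ≠ 0) (hA : A ≠ 0)
    (hv : v ≠ 0) (hv2 : 2 - t * v ≠ 0) (hs : s = 2 * t * q * S)
    (hpd : pd = α * (1 + (1 - t * v) ^ 2) * ρ * p ^ 3 - (2 / ρ) * p
      - s / (A * ρ ^ 2 * (1 - (1 - t * v) ^ 2))) :
    -pd = -(α * (1 + (1 - t * v) ^ 2) * ρ * p ^ 3) + (2 / ρ) * p
      + 2 * q * S / (A * ρ ^ 2 * (v * (2 - t * v))) := by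
  have h : 1 - (1 - t * v) ^ 2 = t * (v * (2 - t * v)) := by ring
  rw [h] at hpd
  subst hs hpd
  field_simp
  ring

theorem IsCOrbit.exists_analyticAt_endpoint {α c : ℝ} {H H' A Z : ℝ → ℝ} {ρ₁ : ℝ}
    (horb : IsCOrbit α c H H' A Z ρ₁) (hend : Tendsto Z (𝓝[<] ρ₁) (𝓝 1))
    (hH : Tendsto H (𝓝[<] ρ₁) (𝓝 0)) {p₁ A₁ : ℝ} (hA₁ : A₁ ≠ 0)
    (hp : Tendsto H' (𝓝[<] ρ₁) (𝓝 p₁)) (hA : Tendsto A (𝓝[<] ρ₁) (𝓝 A₁)) :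
    (∃ g : ℝ → ℝ, AnalyticAt ℝ g ρ₁ ∧ ∀ᶠ ρ in 𝓝[<] ρ₁, H ρ = g ρ) ∧
    (∃ g : ℝ → ℝ, AnalyticAt ℝ g ρ₁ ∧ ∀ᶠ ρ in 𝓝[<] ρ₁, H' ρ = g ρ) ∧
    (∃ g : ℝ → ℝ, AnalyticAt ℝ g ρ₁ ∧ ∀ᶠ ρ in 𝓝[<] ρ₁, A ρ = g ρ) ∧
    ∃ g : ℝ → ℝ, AnalyticAt ℝ g ρ₁ ∧ ∀ᶠ ρ in 𝓝[<] ρ₁, Z ρ = g ρ := by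
  have hρ₁ : ρ₁ ≠ 0 := horb.rho1_pos.ne'
  have hρ₁c : (ρ₁ : ℂ) ≠ 0 := by exact_mod_cast hρ₁
  have hIoo : ∀ᶠ t in 𝓝[>] (0 : ℝ), t ∈ Ioo 0 ρ₁ := Ioo_mem_nhdsGT horb.rho1_pos
  have hid : Tendsto (fun t : ℝ => t) (𝓝[>] 0) (𝓝 0) := nhdsWithin_le_nhds
  have hrefl : Tendsto (fun t : ℝ => ρ₁ - t) (𝓝[>] 0) (𝓝[<] ρ₁) := by
    refine tendsto_nhdsWithin_iff.2 ⟨by simpa using hid.const_sub ρ₁, ?_⟩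
    filter_upwards [self_mem_nhdsWithin] with t ht
    exact sub_lt_self _ (mem_Ioi.1 ht)
  have hmem : ∀ t ∈ Ioo 0 ρ₁, ρ₁ - t ∈ Ioo 0 ρ₁ := fun t ht =>
    ⟨sub_pos.2 ht.2, sub_lt_self _ ht.1⟩
  have hv : Tendsto (fun t => (1 - Z (ρ₁ - t)) / t) (𝓝[>] 0) (𝓝 (1 / ρ₁)) := by
    refine HasDerivAt.lhopital_zero_nhdsGT
      (f' := fun t => Z (ρ₁ - t) * (1 + α * (1 - Z (ρ₁ - t) ^ 2) * (ρ₁ - t) ^ 2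
        * H' (ρ₁ - t) ^ 2) / (ρ₁ - t))
      (g' := fun _ => 1) ?_
      (Eventually.of_forall fun t => hasDerivAt_id t) (by simp) ?_ hid ?_
    · filter_upwards [hIoo] with t ht
      exact (((horb.hZ _ (hmem t ht)).comp_const_sub ρ₁ t).const_sub 1).congr_deriv (neg_neg _)
    · simpa using (hend.comp hrefl).const_sub 1
    · have h1 : Tendsto (fun ρ => Z ρ * (1 + α * (1 - Z ρ ^ 2) * ρ ^ 2 * H' ρ ^ 2) / ρ)
          (𝓝[<] ρ₁) (𝓝 (1 * (1 + α * (1 - 1 ^ 2) * ρ₁ ^ 2 * p₁ ^ 2) / ρ₁)) := by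
        have hid' : Tendsto (fun ρ : ℝ => ρ) (𝓝[<] ρ₁) (𝓝 ρ₁) := nhdsWithin_le_nhds
        exact (hend.mul (((((hend.pow 2).const_sub 1).const_mul α).mul (hid'.pow 2)).mul
          (hp.pow 2) |>.const_add 1)).div hid' hρ₁
      simpa [Function.comp_def] using h1.comp hrefl
  have hq : Tendsto (fun t => H (ρ₁ - t) / t) (𝓝[>] 0) (𝓝 (-p₁)) := by
    refine HasDerivAt.lhopital_zero_nhdsGT (f' := fun t => -H' (ρ₁ - t)) (g' := fun _ => 1) ?_
      (Eventually.of_forall fun t => hasDerivAt_id t) (by simp) ?_ hid ?_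
    · filter_upwards [hIoo] with t ht
      exact (horb.hH _ (hmem t ht)).comp_const_sub ρ₁ t
    · exact hH.comp hrefl
    · simpa using (hp.comp hrefl).neg
  let f : Fin 4 → ℝ → ℝ := ![fun t => (1 - Z (ρ₁ - t)) / t,
    fun t => H (ρ₁ - t) / t + H' (ρ₁ - t), fun t => H' (ρ₁ - t), fun t => A (ρ₁ - t)]
  let u0 : Fin 4 → ℝ := ![1 / ρ₁, 0, p₁, A₁]
  let q : ℂ × (Fin 4 → ℂ) → ℂ := fun x => x.2 1 - x.2 2
  let V : ℂ × (Fin 4 → ℂ) → ℂ := fun x =>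
    (ρ₁ * (-x.2 0 * (1 + α * x.1 * x.2 0 * (2 - x.1 * x.2 0) * (ρ₁ - x.1) ^ 2 * x.2 2 ^ 2)
      + α * x.2 0 * (2 - x.1 * x.2 0) * (ρ₁ - x.1) ^ 2 * x.2 2 ^ 2) + 1) / ((ρ₁ - x.1) * ρ₁)
  let P : ℂ × (Fin 4 → ℂ) → ℂ := fun x =>
    -(α * (1 + (1 - x.1 * x.2 0) ^ 2) * (ρ₁ - x.1) * x.2 2 ^ 3) + (2 / (ρ₁ - x.1)) * x.2 2
      + 2 * q x * complexSinc (2 * x.1 * q x)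
        / (x.2 3 * (ρ₁ - x.1) ^ 2 * (x.2 0 * (2 - x.1 * x.2 0)))
  let G : ℂ × (Fin 4 → ℂ) → Fin 4 → ℂ := fun x =>
    ![V x, P x, P x, 2 * α * (ρ₁ - x.1) * x.2 3 * x.2 2 ^ 2]
  have hpr := fun j => analyticAt_snd_apply (n := 4) j (0, fun j => (u0 j : ℂ))
  have h0 := hpr 0
  have h1 := hpr 1
  have h2 := hpr 2
  have h3 := hpr 3
  have hV : AnalyticAt ℂ V (0, fun j => (u0 j : ℂ)) := by
    simp only [V]
    exact AnalyticAt.div (by fun_prop) (by fun_prop) (by simpa using hρ₁)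
  have hP : AnalyticAt ℂ P (0, fun j => (u0 j : ℂ)) := by
    simp only [P, q]
    refine AnalyticAt.add (by fun_prop (disch := simpa using hρ₁))
      (AnalyticAt.div (by fun_prop) (by fun_prop) ?_)
    simp [u0, hρ₁, hA₁]
  have hG : AnalyticAt ℂ G (0, fun j => (u0 j : ℂ)) := by
    rw [analyticAt_pi_iff]
    intro j
    fin_cases j
    · exact hV
    · exact hP
    · exact hP
    · simp only [Fin.reduceFinMk, Matrix.cons_val]; fun_prop
  have key := exists_real_analyticAt_of_singular_ode ![1, 1, 0, 0] G u0 hG (S := Ioi 0)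
    (fun t ht θ hθ => mul_pos hθ.1 ht) f ?_ ?_
  · obtain ⟨g0, hg0, e0⟩ := key 0
    obtain ⟨g1, hg1, e1⟩ := key 1
    obtain ⟨g2, hg2, e2⟩ := key 2
    obtain ⟨g3, hg3, e3⟩ := key 3
    have hback : Tendsto (fun ρ : ℝ => ρ₁ - ρ) (𝓝[<] ρ₁) (𝓝[>] 0) := by
      refine tendsto_nhdsWithin_iff.2 ⟨?_, ?_⟩
      · have : Tendsto (fun ρ : ℝ => ρ₁ - ρ) (𝓝 ρ₁) (𝓝 0) := by
          simpa using (continuous_sub_left ρ₁).tendsto ρ₁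
        exact this.mono_left nhdsWithin_le_nhds
      · filter_upwards [self_mem_nhdsWithin] with ρ hρ
        exact mem_Ioi.2 (sub_pos.2 (mem_Iio.1 hρ))
    have hcomp : ∀ g : ℝ → ℝ, AnalyticAt ℝ g 0 → AnalyticAt ℝ (fun ρ => g (ρ₁ - ρ)) ρ₁ :=
      fun g hg => AnalyticAt.fun_comp (by simpa using hg) (by fun_prop)
    have k0 := hcomp g0 hg0
    have k1 := hcomp g1 hg1
    have k2 := hcomp g2 hg2
    have k3 := hcomp g3 hg3
    have hl : AnalyticAt ℝ (fun ρ : ℝ => ρ₁ - ρ) ρ₁ := by fun_prop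
    refine ⟨⟨fun ρ => (ρ₁ - ρ) * (g1 (ρ₁ - ρ) - g2 (ρ₁ - ρ)), hl.mul (k1.sub k2), ?_⟩,
      ⟨fun ρ => g2 (ρ₁ - ρ), k2, ?_⟩, ⟨fun ρ => g3 (ρ₁ - ρ), k3, ?_⟩,
      ⟨fun ρ => 1 - (ρ₁ - ρ) * g0 (ρ₁ - ρ), analyticAt_const.sub (hl.mul k0), ?_⟩⟩
    · filter_upwards [hback.eventually e1, hback.eventually e2, hback.eventually hIoo]
        with ρ e1 e2 ht
      have := ht.1.ne'
      rw [← e1, ← e2]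
      simp only [f, Matrix.cons_val, sub_sub_cancel]
      field_simp
      ring
    · filter_upwards [hback.eventually e2] with ρ e2
      rw [← e2]
      simp [f]
    · filter_upwards [hback.eventually e3] with ρ e3
      rw [← e3]
      simp [f]
    · filter_upwards [hback.eventually e0, hback.eventually hIoo] with ρ e0 ht
      have := ht.1.ne'
      rw [← e0]
      simp only [f, Matrix.cons_val, sub_sub_cancel]
      field_simp
      ring
  · intro j
    fin_cases j
    · simpa [f, u0] using hv
    · simpa [f, u0] using hq.add (hp.comp hrefl)
    · exact hp.comp hrefl
    · exact hA.comp hrefl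
  · have hev : ∀ j, ∀ t ∈ Ioo 0 ρ₁, ∃ d : ℝ, HasDerivAt (f j) d t ∧
        (t : ℂ) * d = -(![1, 1, 0, 0] : Fin 4 → ℕ) j * (f j t - u0 j)
          + t * G (t, fun j => (f j t : ℂ)) j := by
      intro j t ht
      have ht0 := ht.1.ne'
      have htc : (t : ℂ) ≠ 0 := by exact_mod_cast ht0
      have hm := hmem t ht
      have hρc : (ρ₁ : ℂ) - t ≠ 0 := by exact_mod_cast hm.1.ne'
      have hAne : (A (ρ₁ - t) : ℂ) ≠ 0 := by exact_mod_cast (horb.hApos _ hm).ne'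
      have hZr := horb.hZ01 _ hm
      obtain ⟨v, hvdef⟩ : ∃ v, v = (1 - Z (ρ₁ - t)) / t := ⟨_, rfl⟩
      obtain ⟨Q, hQ⟩ : ∃ Q, Q = H (ρ₁ - t) / t := ⟨_, rfl⟩
      have hZt : Z (ρ₁ - t) = 1 - t * v := by rw [hvdef]; field_simp; ring
      have hZtc : (Z (ρ₁ - t) : ℂ) = 1 - t * v := by rw [hZt]; push_cast; ring
      have hvne : (v : ℂ) ≠ 0 := by
        have : v ≠ 0 := hvdef ▸ (div_pos (sub_pos.2 hZr.2) ht.1).ne'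
        exact_mod_cast this
      have hv2 : (2 : ℂ) - t * v ≠ 0 := by
        have : 2 - t * v ≠ 0 := by linarith [hZr.1]
        exact_mod_cast this
      have hqc : q (t, fun j => (f j t : ℂ)) = Q := by
        simp [q, f, hQ]
      have hsin : Complex.sin (2 * H (ρ₁ - t)) = 2 * t * Q * complexSinc (2 * t * Q) := by
        rw [mul_complexSinc]
        congr 1
        rw [hQ]
        push_cast
        field_simp
      have hPt : ∀ pd : ℝ, pd = α * (1 + Z (ρ₁ - t) ^ 2) * (ρ₁ - t) * H' (ρ₁ - t) ^ 3
          - (2 / (ρ₁ - t)) * H' (ρ₁ - t) - Real.sin (2 * H (ρ₁ - t))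
            / (A (ρ₁ - t) * (ρ₁ - t) ^ 2 * (1 - Z (ρ₁ - t) ^ 2)) →
          -(pd : ℂ) = P (t, fun j => (f j t : ℂ)) := by
        intro pd hpd
        simp only [P]
        rw [hqc]
        simp only [f, Matrix.cons_val]
        rw [← hvdef]
        refine cone_ode_identity_H htc hρc hAne hvne hv2 hsin ?_
        rw [hpd]
        push_cast
        rw [hZtc]
      have hpd := (horb.hH' _ hm).comp_const_sub ρ₁ t
      have hqd := ((horb.hH _ hm).comp_const_sub ρ₁ t).div (hasDerivAt_id t) ht0
      fin_cases j
      · refine ⟨_, (((horb.hZ _ hm).comp_const_sub ρ₁ t).const_sub 1).div (hasDerivAt_id t) ht0, ?_⟩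
        have := cone_ode_identity_Z (α := α) (ρ₁ := ρ₁) (t := t) (p := H' (ρ₁ - t)) (v := v)
          hρ₁c hρc rfl
        simp only [G, Fin.mk_zero, Matrix.cons_val, u0, V]
        simp only [f, Matrix.cons_val]
        rw [← hvdef, hZt]
        push_cast
        rw [neg_neg, this]
        field_simp
        ring
      · refine ⟨_, hqd.add hpd, ?_⟩
        simp only [G, Fin.mk_one, Matrix.cons_val, u0]
        rw [← hPt _ rfl]
        simp only [f, Matrix.cons_val]
        push_cast
        simp only [id]
        field_simp
        ring
      · refine ⟨_, hpd, ?_⟩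
        simp only [G, Fin.reduceFinMk, Matrix.cons_val, u0]
        rw [← hPt _ rfl]
        push_cast
        ring
      · refine ⟨_, (horb.hA _ hm).comp_const_sub ρ₁ t, ?_⟩
        simp only [G, Fin.reduceFinMk, Matrix.cons_val, u0]
        simp only [f, Matrix.cons_val]
        push_cast
        ring
    intro j
    filter_upwards [hIoo] with t ht using hev j t ht

theorem antitoneOn_Ioo_of_hasDerivAt_nonpos {f f' : ℝ → ℝ} {b r : ℝ}
    (hf : ∀ x ∈ Ioo b r, HasDerivAt f (f' x) x) (hle : ∀ x ∈ Ioo b r, f' x ≤ 0) :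
    AntitoneOn f (Ioo b r) := by
  refine antitoneOn_of_deriv_nonpos (convex_Ioo b r)
    (fun x hx => (hf x hx).continuousAt.continuousWithinAt) ?_ ?_ <;> rw [interior_Ioo]
  · exact fun x hx => (hf x hx).differentiableAt.differentiableWithinAt
  · exact fun x hx => (hf x hx).deriv ▸ hle x hx

theorem le_of_antitoneOn_Ioo_of_tendsto {f : ℝ → ℝ} {b r l : ℝ} (hf : AntitoneOn f (Ioo b r))
    (hl : Tendsto f (𝓝[<] r) (𝓝 l)) {x : ℝ} (hx : x ∈ Ioo b r) : l ≤ f x := by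
  refine le_of_tendsto hl ?_
  filter_upwards [Ioo_mem_nhdsLT hx.2] with y hy
  exact hf hx ⟨hx.1.trans hy.1, hy.2⟩ hy.1.le

theorem exists_tendsto_of_antitoneOn_Ioo {f : ℝ → ℝ} {b r m : ℝ} (hbr : b < r)
    (hf : AntitoneOn f (Ioo b r)) (hm : ∀ x ∈ Ioo b r, m ≤ f x) :
    ∃ l, m ≤ l ∧ Tendsto f (𝓝[<] r) (𝓝 l) := by
  have h := hf.neg.tendsto_nhdsWithin_Ioo_left (nonempty_Ioo.2 hbr)
    ⟨-m, by rintro _ ⟨x, hx, rfl⟩; exact neg_le_neg (hm x hx)⟩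
  refine ⟨_, ?_, by simpa using h.neg⟩
  refine ge_of_tendsto (b := m) (by simpa using h.neg) ?_
  filter_upwards [Ioo_mem_nhdsLT hbr] with x hx using hm x hx

theorem eventually_nhdsLT_iff_Ioo {r : ℝ} {P : ℝ → Prop} :
    (∀ᶠ x in 𝓝[<] r, P x) ↔ ∃ b < r, ∀ x ∈ Ioo b r, P x := by
  simpa using (nhdsLT_basis r).eventually_iff

/-- If `h` tends to zero, `|h'| ≤ -D s'` and `s` tends to zero, then
`h` is bounded by `D s`. -/
theorem abs_le_mul_of_abs_hasDerivAt_le {h p s s' : ℝ → ℝ} {b r D : ℝ}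
    (hh : ∀ x ∈ Ioo b r, HasDerivAt h (p x) x) (hs : ∀ x ∈ Ioo b r, HasDerivAt s (s' x) x)
    (hp : ∀ x ∈ Ioo b r, |p x| ≤ -(D * s' x)) (h0 : Tendsto h (𝓝[<] r) (𝓝 0))
    (s0 : Tendsto s (𝓝[<] r) (𝓝 0)) {x : ℝ} (hx : x ∈ Ioo b r) : |h x| ≤ D * s x := by
  have h1 := le_of_antitoneOn_Ioo_of_tendsto (f := fun x => h x + D * s x)
    (antitoneOn_Ioo_of_hasDerivAt_nonpos (fun x hx => (hh x hx).add ((hs x hx).const_mul D))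
      fun x hx => by linarith [(abs_le.1 (hp x hx)).2])
    (by simpa using h0.add (s0.const_mul D)) hx
  have h2 := le_of_antitoneOn_Ioo_of_tendsto (f := fun x => -h x + D * s x)
    (antitoneOn_Ioo_of_hasDerivAt_nonpos (fun x hx => (hh x hx).neg.add ((hs x hx).const_mul D))
      fun x hx => by linarith [(abs_le.1 (hp x hx)).1])
    (by simpa using h0.neg.add (s0.const_mul D)) hx
  exact abs_le.2 ⟨by linarith, by linarith⟩

theorem exists_tendsto_of_singular_bound {h p p' : ℝ → ℝ} {r K : ℝ} (hK : 0 < K)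
    (hh : ∀ᶠ x in 𝓝[<] r, HasDerivAt h (p x) x) (hp : ∀ᶠ x in 𝓝[<] r, HasDerivAt p (p' x) x)
    (hbd : ∀ᶠ x in 𝓝[<] r, |p' x| ≤ K * (|p x| ^ 3 + |p x| + |h x| / (r - x)))
    (h0 : Tendsto h (𝓝[<] r) (𝓝 0))
    (hp0 : Tendsto (fun x => (r - x) * p x ^ 2) (𝓝[<] r) (𝓝 0)) :
    ∃ p₁, Tendsto p (𝓝[<] r) (𝓝 p₁) := by
  have ht0 : Tendsto (fun x : ℝ => r - x) (𝓝[<] r) (𝓝 0) := by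
    have : Tendsto (fun x : ℝ => r - x) (𝓝 r) (𝓝 0) := by
      simpa using (continuous_sub_left r).tendsto r
    exact this.mono_left nhdsWithin_le_nhds
  obtain ⟨b, hbr, hb⟩ := eventually_nhdsLT_iff_Ioo.1 (hh.and (hp.and (hbd.and
    ((hp0.eventually_lt_const (show (0 : ℝ) < 1 / (16 * K) by positivity)).and
    ((ht0.eventually_lt_const (show (0 : ℝ) < 1 / (16 * K) by positivity)).and
    (ht0.eventually_lt_const (show (0 : ℝ) < 1 by norm_num)))))))
  let y : ℝ → ℝ := fun x => (r - x) ^ (1 / 4 : ℝ)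
  have hy : ∀ x ∈ Ioo b r, 0 < y x ∧ y x ^ 4 = r - x ∧ y x < 1 ∧
      HasDerivAt y (-(1 / (4 * y x ^ 3))) x := by
    intro x hx
    have hx0 : 0 < r - x := sub_pos.2 hx.2
    have hpos : 0 < y x := Real.rpow_pos_of_pos hx0 _
    have h4 : y x ^ 4 = r - x := by
      simp only [y]
      rw [← Real.rpow_natCast, ← Real.rpow_mul hx0.le]
      norm_num
    have h1 : y x < 1 := by
      have := (hb x hx).2.2.2.2.2
      exact Real.rpow_lt_one hx0.le this (by norm_num)
    refine ⟨hpos, h4, h1, ?_⟩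
    have hd := ((hasDerivAt_id x).const_sub r).rpow_const (p := 1 / 4) (Or.inl hx0.ne')
    refine hd.congr_deriv ?_
    have : (r - x) ^ (1 / 4 - 1 : ℝ) = y x / (r - x) := by
      rw [Real.rpow_sub_one hx0.ne']
    simp only [id]
    rw [this, ← h4]
    field_simp
  have y0 : Tendsto y (𝓝[<] r) (𝓝 0) := by
    simpa [y] using ht0.rpow_const (p := 1 / 4) (Or.inr (by norm_num))
  have hy2 : ∀ x ∈ Ioo b r, HasDerivAt (fun x => y x ^ 2) (-(1 / (2 * y x ^ 2))) x := by
    intro x hx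
    obtain ⟨hpos, -, -, hd⟩ := hy x hx
    refine (hd.fun_pow 2).congr_deriv ?_
    field_simp
    norm_num
    ring
  have hy3 : ∀ x ∈ Ioo b r, HasDerivAt (fun x => y x ^ 3) (-(3 / (4 * y x))) x := by
    intro x hx
    obtain ⟨hpos, -, -, hd⟩ := hy x hx
    refine (hd.fun_pow 3).congr_deriv ?_
    field_simp
    norm_num
    ring
  -- first bound: `p = O(t^(-1/2))`, `h = O(t^(1/2))`
  obtain ⟨C, hC, hC2⟩ : ∃ C : ℝ, 0 < C ∧ 1 / (16 * K) ≤ C ^ 2 :=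
    ⟨Real.sqrt (1 / (16 * K)), Real.sqrt_pos.2 (by positivity),
      (Real.sq_sqrt (by positivity)).ge⟩
  have hh1 : ∀ x ∈ Ioo b r, |h x| ≤ 2 * C * y x ^ 2 := by
    intro x hx
    refine abs_le_mul_of_abs_hasDerivAt_le (fun x hx => (hb x hx).1) hy2 ?_ h0
      (by simpa using y0.pow 2) hx
    intro x hx
    obtain ⟨hpos, h4, -, -⟩ := hy x hx
    have hlt := (hb x hx).2.2.2.1
    rw [← h4] at hlt
    have : |y x ^ 2 * p x| ≤ C := abs_le_of_sq_le_sq (by nlinarith) hC.le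
    rw [abs_mul, abs_of_pos (by positivity)] at this
    have e : -(2 * C * -(1 / (2 * y x ^ 2))) = C / y x ^ 2 := by field_simp
    rw [e, le_div_iff₀ (by positivity)]
    linarith
  have hp1 : ∀ x ∈ Ioo b r, |p' x| * y x ^ 4 ≤ |p x| / 8 + 2 * K * C * y x ^ 2 := by
    intro x hx
    obtain ⟨hpos, h4, -, -⟩ := hy x hx
    obtain ⟨-, -, hbx, hx1, hx2, -⟩ := hb x hx
    rw [← h4] at hbx hx1 hx2
    rw [lt_div_iff₀ (by positivity)] at hx1 hx2
    have hab := abs_nonneg (p x)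
    have h1 := mul_le_mul_of_nonneg_right hbx (pow_pos hpos 4).le
    have h2 : K * (|p x| ^ 3 + |p x| + |h x| / y x ^ 4) * y x ^ 4
        = (y x ^ 4 * p x ^ 2 * (16 * K)) * |p x| / 16 + (y x ^ 4 * (16 * K)) * |p x| / 16
          + K * |h x| := by
      rw [← sq_abs (p x)]
      field_simp
    have h3 := mul_le_mul_of_nonneg_right hx1.le hab
    have h4 := mul_le_mul_of_nonneg_right hx2.le hab
    have h5 := mul_le_mul_of_nonneg_left (hh1 x hx) hK.le
    linarith
  -- second bound: `p = O(t^(-1/4))`, `h = O(t^(3/4))`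
  obtain ⟨M, hM, hM2⟩ : ∃ M : ℝ, 0 < M ∧ ∀ x ∈ Ioo ((b + r) / 2) r, y x * |p x| ≤ M := by
    let N : ℝ → ℝ := fun x => y x ^ 2 * p x ^ 2 - (4 * K * C) ^ 2 * x
    have hN : AntitoneOn N (Ioo b r) := by
      refine antitoneOn_Ioo_of_hasDerivAt_nonpos (fun x hx =>
        ((hy2 x hx).fun_mul ((hb x hx).2.1.fun_pow 2)).sub
          ((hasDerivAt_id x).const_mul ((4 * K * C) ^ 2))) ?_
      intro x hx
      obtain ⟨hpos, h4, hlt, -⟩ := hy x hx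
      have hab := abs_nonneg (p x)
      have h1 := hp1 x hx
      have h2 : y x ^ 2 * (p x * p' x) ≤ |p x| * (|p x| / 8 + 2 * K * C * y x ^ 2) / y x ^ 2 := by
        rw [le_div_iff₀ (by positivity)]
        calc y x ^ 2 * (p x * p' x) * y x ^ 2 ≤ y x ^ 2 * |p x * p' x| * y x ^ 2 := by
              gcongr; exact le_abs_self _
          _ = |p x| * (|p' x| * y x ^ 4) := by rw [abs_mul]; ring
          _ ≤ _ := by gcongr
      have h3 : |p x| * (|p x| / 8 + 2 * K * C * y x ^ 2) / y x ^ 2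
          = |p x| ^ 2 / (8 * y x ^ 2) + 2 * K * C * |p x| := by
        field_simp
      have h5 : |p x| ^ 2 / (4 * y x ^ 2) - 4 * K * C * |p x| + (4 * K * C) ^ 2 * y x ^ 2
          = (|p x| / (2 * y x) - 4 * K * C * y x) ^ 2 := by
        field_simp
        ring
      have h6 := sq_nonneg (|p x| / (2 * y x) - 4 * K * C * y x)
      have h7 : (4 * K * C) ^ 2 * y x ^ 2 ≤ (4 * K * C) ^ 2 * 1 := by
        gcongr
        exact pow_le_one₀ hpos.le hlt.le
      have h8 : -(1 / (2 * y x ^ 2)) * p x ^ 2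
          = - 2 * (|p x| ^ 2 / (4 * y x ^ 2)) := by
        rw [← sq_abs (p x)]
        field_simp
        norm_num
        ring
      have h9 : |p x| ^ 2 / (8 * y x ^ 2) = (|p x| ^ 2 / (4 * y x ^ 2)) / 2 := by
        field_simp
        norm_num
        ring
      rw [h3, h9] at h2
      have h10 : y x ^ 2 * ((2 : ℕ) * p x ^ (2 - 1) * p' x) = 2 * (y x ^ 2 * (p x * p' x)) := by
        norm_num
        ring
      rw [h8, h10]
      linarith
    have hm : (b + r) / 2 ∈ Ioo b r := ⟨by linarith, by linarith⟩
    let B : ℝ := |N ((b + r) / 2) + (4 * K * C) ^ 2 * r| + 1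
    refine ⟨Real.sqrt B, Real.sqrt_pos.2 (by positivity), fun x hx => ?_⟩
    have hxb : x ∈ Ioo b r := ⟨by linarith [hx.1], hx.2⟩
    have h1 := hN hm hxb hx.1.le
    refine Real.le_sqrt_of_sq_le ?_
    rw [mul_pow, sq_abs]
    have h2 : y x ^ 2 * p x ^ 2 ≤ N ((b + r) / 2) + (4 * K * C) ^ 2 * x := by
      linarith
    have h3 : (4 * K * C) ^ 2 * x ≤ (4 * K * C) ^ 2 * r := by
      gcongr
      exact hx.2.le
    have h5 := le_abs_self (N ((b + r) / 2) + (4 * K * C) ^ 2 * r)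
    linarith
  set a := (b + r) / 2 with ha
  have har : a < r := by linarith
  have hsub : Ioo a r ⊆ Ioo b r := Ioo_subset_Ioo_left (by linarith)
  have hh2 : ∀ x ∈ Ioo a r, |h x| ≤ 4 / 3 * M * y x ^ 3 := by
    intro x hx
    refine abs_le_mul_of_abs_hasDerivAt_le (fun x hx => (hb x (hsub hx)).1)
      (fun x hx => hy3 x (hsub hx)) ?_ h0 (by simpa using y0.pow 3) hx
    intro x hx
    obtain ⟨hpos, -, -, -⟩ := hy x (hsub hx)
    have e : -(4 / 3 * M * -(3 / (4 * y x))) = M / y x := by field_simp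
    rw [e, le_div_iff₀ hpos, mul_comm]
    exact hM2 x hx
  -- conclusion: `p' = O(t^(-3/4))` is integrable
  obtain ⟨L, hL⟩ : ∃ L : ℝ, ∀ x ∈ Ioo a r, |p' x| ≤ L / y x ^ 3 := by
    refine ⟨K * (M ^ 3 + M + 4 / 3 * M), fun x hx => ?_⟩
    obtain ⟨hpos, h4, hlt, -⟩ := hy x (hsub hx)
    have hbx := (hb x (hsub hx)).2.2.1
    rw [← h4] at hbx
    refine hbx.trans ?_
    rw [mul_div_assoc]
    refine mul_le_mul_of_nonneg_left ?_ hK.le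
    rw [le_div_iff₀ (by positivity)]
    have h1 : (|p x| ^ 3 + |p x| + |h x| / y x ^ 4) * y x ^ 3
        = (y x * |p x|) ^ 3 + (y x * |p x|) * y x ^ 2 + |h x| / y x := by
      field_simp
    have h2 : |h x| / y x ≤ 4 / 3 * M := by
      rw [div_le_iff₀ hpos]
      refine (hh2 x hx).trans ?_
      gcongr
      exact pow_le_of_le_one hpos.le hlt.le (by norm_num)
    have h3 : (y x * |p x|) ^ 3 ≤ M ^ 3 := pow_le_pow_left₀ (by positivity) (hM2 x hx) 3
    have h5 : (y x * |p x|) * y x ^ 2 ≤ M * 1 := by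
      have := hM2 x hx
      gcongr
      exact pow_le_one₀ hpos.le hlt.le
    rw [h1]
    linarith
  have hyL : ∀ x ∈ Ioo a r, HasDerivAt (fun x => 4 * L * y x) (-(L / y x ^ 3)) x := by
    intro x hx
    obtain ⟨hpos, -, -, hd⟩ := hy x (hsub hx)
    refine (hd.const_mul (4 * L)).congr_deriv ?_
    field_simp
  have hL0 : 0 ≤ L := by
    have hm : (a + r) / 2 ∈ Ioo a r := ⟨by linarith, by linarith⟩
    have := (abs_nonneg _).trans (hL _ hm)
    have hpos := (hy _ (hsub hm)).1
    exact le_of_not_gt fun hneg => this.not_gt (div_neg_of_neg_of_pos hneg (by positivity))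
  have hdec : AntitoneOn (fun x => p x + 4 * L * y x) (Ioo a r) :=
    antitoneOn_Ioo_of_hasDerivAt_nonpos (fun x hx => (hb x (hsub hx)).2.1.add (hyL x hx))
      fun x hx => by linarith [(abs_le.1 (hL x hx)).2]
  have hinc : AntitoneOn (fun x => -p x + 4 * L * y x) (Ioo a r) :=
    antitoneOn_Ioo_of_hasDerivAt_nonpos (fun x hx => (hb x (hsub hx)).2.1.neg.add (hyL x hx))
      fun x hx => by linarith [(abs_le.1 (hL x hx)).1]
  have hm : (a + r) / 2 ∈ Ioo a r := ⟨by linarith, by linarith⟩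
  obtain ⟨l, -, hl⟩ := exists_tendsto_of_antitoneOn_Ioo
    (f := fun x => p x + 4 * L * y x) (b := (a + r) / 2) (r := r)
    (m := p ((a + r) / 2) - 4 * L * y ((a + r) / 2)) (by linarith)
    (hdec.mono (Ioo_subset_Ioo_left hm.1.le)) fun x hx => by
      have hxa : x ∈ Ioo a r := ⟨hm.1.trans hx.1, hx.2⟩
      have h1 := hinc hm hxa hx.1.le
      have h2 : 0 ≤ 4 * L * y x := mul_nonneg (by linarith) (hy x (hsub hxa)).1.le
      simp only at h1
      linarith
  exact ⟨l, by simpa using hl.sub (y0.const_mul (4 * L))⟩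

/-- The quantity `α ρ² H'² (1 - Z²)` expressed through the constraint. -/
theorem IsCOrbit.flux_eq {α c : ℝ} {H H' A Z : ℝ → ℝ} {ρ₁ : ℝ} (horb : IsCOrbit α c H H' A Z ρ₁)
    {ρ : ℝ} (hρ : ρ ∈ Ioo 0 ρ₁) :
    α * ρ ^ 2 * H' ρ ^ 2 * (1 - Z ρ ^ 2)
      = 1 - (1 - 2 * α + 2 * α * Real.sin (H ρ) ^ 2) / A ρ := by
  have hA := (horb.hApos ρ hρ).ne'
  rw [eq_sub_iff_add_eq, ← eq_sub_iff_add_eq', div_eq_iff hA]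
  linear_combination horb.constraint ρ hρ

theorem IsCOrbit.flux_nonneg {α c : ℝ} {H H' A Z : ℝ → ℝ} {ρ₁ : ℝ}
    (horb : IsCOrbit α c H H' A Z ρ₁) (hα0 : 0 < α) {ρ : ℝ} (hρ : ρ ∈ Ioo 0 ρ₁) :
    0 ≤ α * ρ ^ 2 * H' ρ ^ 2 * (1 - Z ρ ^ 2) := by
  have hZ := horb.hZ01 ρ hρ
  have : 0 ≤ 1 - Z ρ ^ 2 := by nlinarith
  positivity

theorem IsCOrbit.flux_lt_one {α c : ℝ} {H H' A Z : ℝ → ℝ} {ρ₁ : ℝ}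
    (horb : IsCOrbit α c H H' A Z ρ₁) (hα0 : 0 < α) (hα : α < 1 / 2) {ρ : ℝ}
    (hρ : ρ ∈ Ioo 0 ρ₁) : α * ρ ^ 2 * H' ρ ^ 2 * (1 - Z ρ ^ 2) < 1 := by
  rw [horb.flux_eq hρ]
  have h1 : 0 < 1 - 2 * α + 2 * α * Real.sin (H ρ) ^ 2 := by
    have : 0 ≤ 2 * α * Real.sin (H ρ) ^ 2 := by positivity
    linarith
  linarith [div_pos h1 (horb.hApos ρ hρ)]

theorem IsCOrbit.le_A {α c : ℝ} {H H' A Z : ℝ → ℝ} {ρ₁ : ℝ}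
    (horb : IsCOrbit α c H H' A Z ρ₁) (hα0 : 0 < α) {ρ : ℝ}
    (hρ : ρ ∈ Ioo 0 ρ₁) : 1 - 2 * α ≤ A ρ := by
  have h1 := mul_nonneg (horb.hApos ρ hρ).le (horb.flux_nonneg hα0 hρ)
  have h2 : 0 ≤ 2 * α * Real.sin (H ρ) ^ 2 := by positivity
  linarith [horb.constraint ρ hρ]

theorem IsCOrbit.exists_tendsto_A {α c : ℝ} {H H' A Z : ℝ → ℝ} {ρ₁ : ℝ}
    (horb : IsCOrbit α c H H' A Z ρ₁) (hα0 : 0 < α) :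
    ∃ A₁, 1 - 2 * α ≤ A₁ ∧ Tendsto A (𝓝[<] ρ₁) (𝓝 A₁) := by
  refine exists_tendsto_of_antitoneOn_Ioo horb.rho1_pos
    (antitoneOn_Ioo_of_hasDerivAt_nonpos horb.hA fun ρ hρ => ?_) fun ρ hρ => horb.le_A hα0 hρ
  have := mul_nonneg (mul_nonneg (mul_nonneg hα0.le hρ.1.le) (horb.hApos ρ hρ).le)
    (sq_nonneg (H' ρ))
  linarith

/-- Near the light cone, `1 - Z²` is comparable to the distance to the cone. -/
theorem IsCOrbit.eventually_one_sub_sq_bounds {α c : ℝ} {H H' A Z : ℝ → ℝ} {ρ₁ : ℝ}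
    (horb : IsCOrbit α c H H' A Z ρ₁) (hα0 : 0 < α) (hα : α < 1 / 2)
    (hend : Tendsto Z (𝓝[<] ρ₁) (𝓝 1)) :
    ∀ᶠ ρ in 𝓝[<] ρ₁, (ρ₁ - ρ) / (2 * ρ₁) ≤ 1 - Z ρ ^ 2 ∧ 1 - Z ρ ^ 2 ≤ 8 / ρ₁ * (ρ₁ - ρ) := by
  have hρ₁ := horb.rho1_pos
  obtain ⟨b, hb, hZb⟩ := eventually_nhdsLT_iff_Ioo.1
    ((hend.eventually_const_lt (show (1 / 2 : ℝ) < 1 by norm_num)).and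
      (Ioo_mem_nhdsLT (show ρ₁ / 2 < ρ₁ by linarith)))
  have hm : ∀ ρ ∈ Ioo b ρ₁, ρ ∈ Ioo 0 ρ₁ := fun ρ hρ =>
    ⟨by linarith [(hZb ρ hρ).2.1], hρ.2⟩
  have hid : Tendsto (fun ρ : ℝ => ρ) (𝓝[<] ρ₁) (𝓝 ρ₁) := nhdsWithin_le_nhds
  have hlow : AntitoneOn (fun ρ => 1 / (2 * ρ₁) * ρ - Z ρ) (Ioo b ρ₁) := by
    refine antitoneOn_Ioo_of_hasDerivAt_nonpos (fun ρ hρ =>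
      ((hasDerivAt_id ρ).const_mul (1 / (2 * ρ₁))).sub (horb.hZ ρ (hm ρ hρ))) fun ρ hρ => ?_
    have hρ0 := (hm ρ hρ).1
    have h1 : 1 / (2 * ρ₁) ≤ Z ρ * (1 + α * (1 - Z ρ ^ 2) * ρ ^ 2 * H' ρ ^ 2) / ρ := by
      rw [div_le_div_iff₀ (by positivity) hρ0]
      have h2 := mul_nonneg (horb.hZ01 ρ (hm ρ hρ)).1 (horb.flux_nonneg hα0 (hm ρ hρ))
      have h3 : 1 / 2 ≤ Z ρ * (1 + α * (1 - Z ρ ^ 2) * ρ ^ 2 * H' ρ ^ 2) := by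
        linarith [(hZb ρ hρ).1]
      nlinarith [hρ.2]
    linarith
  have hup : AntitoneOn (fun ρ => Z ρ - 4 / ρ₁ * ρ) (Ioo b ρ₁) := by
    refine antitoneOn_Ioo_of_hasDerivAt_nonpos (fun ρ hρ =>
      (horb.hZ ρ (hm ρ hρ)).sub ((hasDerivAt_id ρ).const_mul (4 / ρ₁))) fun ρ hρ => ?_
    have hρ0 := (hm ρ hρ).1
    have hZ := horb.hZ01 ρ (hm ρ hρ)
    have h1 : Z ρ * (1 + α * (1 - Z ρ ^ 2) * ρ ^ 2 * H' ρ ^ 2) / ρ ≤ 4 / ρ₁ := by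
      rw [div_le_div_iff₀ hρ0 hρ₁]
      have h2 := horb.flux_lt_one hα0 hα (hm ρ hρ)
      have h4 := horb.flux_nonneg hα0 (hm ρ hρ)
      have h3 : Z ρ * (1 + α * (1 - Z ρ ^ 2) * ρ ^ 2 * H' ρ ^ 2) ≤ 1 * 2 := by
        refine mul_le_mul hZ.2.le (by linarith) (by linarith) (by norm_num)
      nlinarith [(hZb ρ hρ).2.1]
    linarith
  filter_upwards [Ioo_mem_nhdsLT hb] with ρ hρ
  have hZ := horb.hZ01 ρ (hm ρ hρ)
  have h1 := le_of_antitoneOn_Ioo_of_tendsto hlow ((hid.const_mul _).sub hend) hρ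
  have h2 := le_of_antitoneOn_Ioo_of_tendsto hup (hend.sub (hid.const_mul _)) hρ
  have e1 : (ρ₁ - ρ) / (2 * ρ₁) = 1 / (2 * ρ₁) * ρ₁ - 1 / (2 * ρ₁) * ρ := by ring
  have e2 : 8 / ρ₁ * (ρ₁ - ρ) = 2 * (4 / ρ₁ * ρ₁ - 4 / ρ₁ * ρ) := by ring
  rw [e1, e2]
  constructor <;> nlinarith

theorem IsCOrbit.tendsto_flux_zero {α c : ℝ} {H H' A Z : ℝ → ℝ} {ρ₁ : ℝ}
    (horb : IsCOrbit α c H H' A Z ρ₁) (hα0 : 0 < α) (hα : α < 1 / 2)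
    (hend : Tendsto Z (𝓝[<] ρ₁) (𝓝 1)) {h₁ : ℝ} (hH : Tendsto H (𝓝[<] ρ₁) (𝓝 h₁)) :
    Tendsto (fun ρ => α * ρ ^ 2 * H' ρ ^ 2 * (1 - Z ρ ^ 2)) (𝓝[<] ρ₁) (𝓝 0) := by
  have hρ₁ := horb.rho1_pos
  obtain ⟨A₁, hA₁, hA⟩ := horb.exists_tendsto_A hα0
  have hA₁0 : 0 < A₁ := by linarith
  have hmem : ∀ᶠ ρ in 𝓝[<] ρ₁, ρ ∈ Ioo 0 ρ₁ := Ioo_mem_nhdsLT hρ₁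
  have hw : Tendsto (fun ρ => α * ρ ^ 2 * H' ρ ^ 2 * (1 - Z ρ ^ 2)) (𝓝[<] ρ₁)
      (𝓝 (1 - (1 - 2 * α + 2 * α * Real.sin h₁ ^ 2) / A₁)) := by
    refine ((((((continuous_sin.tendsto h₁).comp hH).pow 2).const_mul
      (2 * α)).const_add (1 - 2 * α)).div hA hA₁0.ne').const_sub 1 |>.congr' ?_
    filter_upwards [hmem] with ρ hρ
    exact (horb.flux_eq hρ).symm
  set w := 1 - (1 - 2 * α + 2 * α * Real.sin h₁ ^ 2) / A₁
  have hw0 : 0 ≤ w := by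
    refine ge_of_tendsto hw ?_
    filter_upwards [hmem] with ρ hρ using horb.flux_nonneg hα0 hρ
  rcases hw0.eq_or_lt with h | hwpos
  · rwa [← h] at hw
  exfalso
  obtain ⟨b, hb, hbb⟩ := eventually_nhdsLT_iff_Ioo.1 (hmem.and
    ((hw.eventually_const_lt (half_lt_self hwpos)).and
      (horb.eventually_one_sub_sq_bounds hα0 hα hend)))
  let k := (1 - 2 * α) * w / 8
  have hk : 0 < k := by
    have : 0 < 1 - 2 * α := by linarith
    positivity
  have hanti : AntitoneOn (fun ρ => A ρ - k * Real.log (ρ₁ - ρ)) (Ioo b ρ₁) := by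
    refine antitoneOn_Ioo_of_hasDerivAt_nonpos (fun ρ hρ => (horb.hA ρ (hbb ρ hρ).1).sub
      ((((hasDerivAt_id ρ).const_sub ρ₁).log (sub_pos.2 hρ.2).ne').const_mul k)) fun ρ hρ => ?_
    obtain ⟨hm, hwρ, -, hZ⟩ := hbb ρ hρ
    have ht : 0 < ρ₁ - ρ := sub_pos.2 hρ.2
    have hρ0 := hm.1
    have hAρ := horb.le_A hα0 hm
    have h1 : w / 2 < α * ρ ^ 2 * H' ρ ^ 2 * (8 / ρ₁ * (ρ₁ - ρ)) :=
      hwρ.trans_le (by gcongr)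
    have h2 : w / 16 ≤ α * ρ * H' ρ ^ 2 * (ρ₁ - ρ) := by
      have e : α * ρ ^ 2 * H' ρ ^ 2 * (8 / ρ₁ * (ρ₁ - ρ))
          = 8 * (α * ρ * H' ρ ^ 2 * (ρ₁ - ρ)) * (ρ / ρ₁) := by
        field_simp
      have h3 : 8 * (α * ρ * H' ρ ^ 2 * (ρ₁ - ρ)) * (ρ / ρ₁)
          ≤ 8 * (α * ρ * H' ρ ^ 2 * (ρ₁ - ρ)) * 1 := by
        gcongr
        exact (div_le_one hρ₁).2 hρ.2.le
      linarith
    have h3 : k ≤ 2 * α * ρ * A ρ * H' ρ ^ 2 * (ρ₁ - ρ) := by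
      have := mul_le_mul hAρ h2 (by positivity) (horb.hApos ρ hm).le
      simp only [k]
      linarith
    rw [← div_le_iff₀ ht] at h3
    have e : k * (-1 / (ρ₁ - id ρ)) = -(k / (ρ₁ - ρ)) := by
      simp only [id]
      ring
    rw [e]
    linarith
  have hlog : Tendsto (fun ρ => -(k * Real.log (ρ₁ - ρ))) (𝓝[<] ρ₁) atTop := by
    have ht : Tendsto (fun ρ => ρ₁ - ρ) (𝓝[<] ρ₁) (𝓝[>] 0) := by
      refine tendsto_nhdsWithin_iff.2 ⟨?_, ?_⟩
      · have : Tendsto (fun ρ : ℝ => ρ₁ - ρ) (𝓝 ρ₁) (𝓝 0) := by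
          simpa using (continuous_sub_left ρ₁).tendsto ρ₁
        exact this.mono_left nhdsWithin_le_nhds
      · filter_upwards [self_mem_nhdsWithin] with ρ hρ
        exact mem_Ioi.2 (sub_pos.2 (mem_Iio.1 hρ))
    exact tendsto_neg_atBot_atTop.comp ((Real.tendsto_log_nhdsGT_zero.comp ht).const_mul_atBot hk)
  have hm : (b + ρ₁) / 2 ∈ Ioo b ρ₁ := ⟨by linarith, by linarith⟩
  obtain ⟨ρ, hρ, hmρ⟩ := ((hlog.eventually_gt_atTop
    (A ((b + ρ₁) / 2) - k * Real.log (ρ₁ - (b + ρ₁) / 2))).and (Ioo_mem_nhdsLT hm.2)).exists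
  have hρb : ρ ∈ Ioo b ρ₁ := ⟨hm.1.trans hmρ.1, hmρ.2⟩
  have h1 := hanti hm hρb hmρ.1.le
  simp only at h1
  linarith [horb.hApos ρ (hbb ρ hρb).1]

theorem IsCOrbit.exists_tendsto_H' {α c : ℝ} {H H' A Z : ℝ → ℝ} {ρ₁ : ℝ}
    (horb : IsCOrbit α c H H' A Z ρ₁) (hα0 : 0 < α) (hα : α < 1 / 2)
    (hend : Tendsto Z (𝓝[<] ρ₁) (𝓝 1)) (hH : Tendsto H (𝓝[<] ρ₁) (𝓝 0)) :
    ∃ p₁, Tendsto H' (𝓝[<] ρ₁) (𝓝 p₁) := by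
  have hρ₁ := horb.rho1_pos
  have h2α : 0 < 1 - 2 * α := by linarith
  have hmem : ∀ᶠ ρ in 𝓝[<] ρ₁, ρ ∈ Ioo 0 ρ₁ := Ioo_mem_nhdsLT hρ₁
  have hhalf : ∀ᶠ ρ in 𝓝[<] ρ₁, ρ ∈ Ioo (ρ₁ / 2) ρ₁ := Ioo_mem_nhdsLT (by linarith)
  have hZ := horb.eventually_one_sub_sq_bounds hα0 hα hend
  let K := 2 * α * ρ₁ + 4 / ρ₁ + 16 / ((1 - 2 * α) * ρ₁)
  refine exists_tendsto_of_singular_bound (K := K) (by positivity) (hmem.mono horb.hH)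
    (hmem.mono horb.hH') ?_ hH ?_
  · filter_upwards [hmem, hhalf, hZ] with ρ hρ hρ2 hZρ
    have ht : 0 < ρ₁ - ρ := sub_pos.2 hρ.2
    have hρ0 := hρ.1
    have hA := horb.le_A hα0 hρ
    have hZ01 := horb.hZ01 ρ hρ
    have h1 : |α * (1 + Z ρ ^ 2) * ρ * H' ρ ^ 3| ≤ 2 * α * ρ₁ * |H' ρ| ^ 3 := by
      rw [abs_mul, abs_pow, abs_of_pos (by positivity)]
      have : Z ρ ^ 2 ≤ 1 := pow_le_one₀ hZ01.1 hZ01.2.le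
      calc α * (1 + Z ρ ^ 2) * ρ * |H' ρ| ^ 3 ≤ α * (1 + 1) * ρ₁ * |H' ρ| ^ 3 := by
            gcongr
            exact hρ.2.le
        _ = _ := by ring
    have h2 : |2 / ρ * H' ρ| ≤ 4 / ρ₁ * |H' ρ| := by
      rw [abs_mul, abs_of_pos (by positivity)]
      gcongr ?_ * _
      rw [div_le_div_iff₀ hρ0 hρ₁]
      linarith [hρ2.1]
    have h3 : |Real.sin (2 * H ρ) / (A ρ * ρ ^ 2 * (1 - Z ρ ^ 2))|
        ≤ 16 / ((1 - 2 * α) * ρ₁) * (|H ρ| / (ρ₁ - ρ)) := by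
      have hs : |Real.sin (2 * H ρ)| ≤ 2 * |H ρ| := by
        refine Real.abs_sin_le_abs.trans ?_
        rw [abs_mul, abs_two]
      have hd : (1 - 2 * α) * (ρ₁ / 2) ^ 2 * ((ρ₁ - ρ) / (2 * ρ₁))
          ≤ A ρ * ρ ^ 2 * (1 - Z ρ ^ 2) := by
        have := hZρ.1
        have := horb.hApos ρ hρ
        gcongr
        exact hρ2.1.le
      have hd0 : 0 < (1 - 2 * α) * (ρ₁ / 2) ^ 2 * ((ρ₁ - ρ) / (2 * ρ₁)) := by positivity
      rw [abs_div, abs_of_pos (hd0.trans_le hd)]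
      calc _ ≤ 2 * |H ρ| / ((1 - 2 * α) * (ρ₁ / 2) ^ 2 * ((ρ₁ - ρ) / (2 * ρ₁))) := by gcongr
        _ = _ := by
          field_simp
          norm_num
          ring
    have h4 : 0 ≤ |H' ρ| ^ 3 := by positivity
    have h5 : 0 ≤ |H ρ| / (ρ₁ - ρ) := by positivity
    have k1 : 0 ≤ 2 * α * ρ₁ := by positivity
    have k2 : 0 ≤ 4 / ρ₁ := by positivity
    have k3 : 0 ≤ 16 / ((1 - 2 * α) * ρ₁) := by positivity
    have hab := abs_nonneg (H' ρ)
    refine (abs_sub _ _).trans ((add_le_add_left (abs_sub _ _) _).trans ?_)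
    have m1 : 2 * α * ρ₁ * |H' ρ| ^ 3 ≤ K * |H' ρ| ^ 3 := by
      gcongr
      simp only [K]
      linarith
    have m2 : 4 / ρ₁ * |H' ρ| ≤ K * |H' ρ| := by
      gcongr
      simp only [K]
      linarith
    have m3 : 16 / ((1 - 2 * α) * ρ₁) * (|H ρ| / (ρ₁ - ρ)) ≤ K * (|H ρ| / (ρ₁ - ρ)) := by
      gcongr
      simp only [K]
      linarith
    linarith
  · have hw := (horb.tendsto_flux_zero hα0 hα hend hH).const_mul (8 / (α * ρ₁))
    rw [mul_zero] at hw
    refine squeeze_zero' ?_ ?_ hw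
    · filter_upwards [hmem] with ρ hρ
      exact mul_nonneg (sub_pos.2 hρ.2).le (sq_nonneg _)
    · filter_upwards [hmem, hhalf, hZ] with ρ hρ hρ2 hZρ
      have ht : 0 < ρ₁ - ρ := sub_pos.2 hρ.2
      have h1 := hZρ.1
      have h2 := hρ2.1.le
      calc (ρ₁ - ρ) * H' ρ ^ 2
          = 8 / (α * ρ₁) * (α * (ρ₁ / 2) ^ 2 * H' ρ ^ 2 * ((ρ₁ - ρ) / (2 * ρ₁))) := by
            field_simp
            norm_num
        _ ≤ _ := by gcongr

/-- Gluing an analytic function on an open interval with analytic germs at both endpoints. -/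
theorem exists_analyticOnNhd_Icc_extension {f : ℝ → ℝ} {r : ℝ} (hr : 0 < r)
    (hf : ∀ x ∈ Ioo 0 r, AnalyticAt ℝ f x)
    (h0 : ∃ g : ℝ → ℝ, AnalyticAt ℝ g 0 ∧ ∀ᶠ x in 𝓝[>] 0, f x = g x)
    (h1 : ∃ g : ℝ → ℝ, AnalyticAt ℝ g r ∧ ∀ᶠ x in 𝓝[<] r, f x = g x) :
    ∃ F : ℝ → ℝ, EqOn F f (Ioo 0 r) ∧ AnalyticOnNhd ℝ F (Icc 0 r) ∧
      Tendsto f (𝓝[<] r) (𝓝 (F r)) := by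
  obtain ⟨g0, hg0, e0⟩ := h0
  obtain ⟨g1, hg1, e1⟩ := h1
  let F : ℝ → ℝ := fun x => if x ≤ 0 then g0 x else if x < r then f x else g1 x
  have hF : EqOn F f (Ioo 0 r) := fun x hx => by simp [F, hx.1.not_ge, hx.2]
  have hF0 : g0 =ᶠ[𝓝 0] F := by
    filter_upwards [eventually_nhdsWithin_iff.1 e0, Iio_mem_nhds hr] with x hx hxr
    by_cases h : x ≤ 0
    · simp [F, h]
    · simp [F, h, mem_Iio.1 hxr, hx (not_le.1 h)]
  have hF1 : g1 =ᶠ[𝓝 r] F := by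
    filter_upwards [eventually_nhdsWithin_iff.1 e1, Ioi_mem_nhds hr] with x hx hx0
    by_cases h : x < r
    · simp [F, h, (mem_Ioi.1 hx0).not_ge, hx h]
    · simp [F, h, (mem_Ioi.1 hx0).not_ge]
  refine ⟨F, hF, fun x hx => ?_, ?_⟩
  · rcases hx.1.eq_or_lt with rfl | hx0
    · exact hg0.congr hF0
    rcases hx.2.eq_or_lt with rfl | hxr
    · exact hg1.congr hF1
    · refine (hf x ⟨hx0, hxr⟩).congr ?_
      filter_upwards [Ioo_mem_nhds hx0 hxr] with y hy using (hF hy).symm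
  · have := (hg1.congr hF1).continuousAt.tendsto.mono_left (nhdsWithin_le_nhds (s := Iio r))
    refine this.congr' ?_
    filter_upwards [Ioo_mem_nhdsLT hr] with y hy using hF hy

/-- Corollary 5: a `c`-orbit with `H̄ = 0` extends to a real-analytic solution
on the whole closed interval `[0, ρ₁(c)]`; in particular `H, H', A, Z` have
finite limits at `ρ₁(c)` and the extensions are analytic there. -/
theorem corollary5 (α : ℝ) (hα0 : 0 < α) (hα : α < 1 / 2)
    (c : ℝ) (hc : 0 < c) (H H' A Z : ℝ → ℝ) (ρ₁ : ℝ)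
    (horb : IsCOrbit α c H H' A Z ρ₁)
    (hend : Tendsto Z (𝓝[<] ρ₁) (𝓝 1))
    (hHbar : Tendsto H (𝓝[<] ρ₁) (𝓝 0)) :
    ∃ He H'e Ae Ze : ℝ → ℝ,
      Set.EqOn He H (Set.Ioo 0 ρ₁) ∧ Set.EqOn H'e H' (Set.Ioo 0 ρ₁) ∧
      Set.EqOn Ae A (Set.Ioo 0 ρ₁) ∧ Set.EqOn Ze Z (Set.Ioo 0 ρ₁) ∧
      AnalyticOnNhd ℝ He (Set.Icc 0 ρ₁) ∧ AnalyticOnNhd ℝ H'e (Set.Icc 0 ρ₁) ∧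
      AnalyticOnNhd ℝ Ae (Set.Icc 0 ρ₁) ∧ AnalyticOnNhd ℝ Ze (Set.Icc 0 ρ₁) ∧
      (∀ ρ ∈ Set.Ioo 0 ρ₁, HasDerivAt He (H'e ρ) ρ) ∧
      Tendsto H (𝓝[<] ρ₁) (𝓝 (He ρ₁)) ∧ Tendsto H' (𝓝[<] ρ₁) (𝓝 (H'e ρ₁)) ∧
      Tendsto A (𝓝[<] ρ₁) (𝓝 (Ae ρ₁)) ∧ Tendsto Z (𝓝[<] ρ₁) (𝓝 (Ze ρ₁)) := by
  obtain ⟨A₁, hA₁, hA⟩ := horb.exists_tendsto_A hα0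
  obtain ⟨p₁, hp⟩ := horb.exists_tendsto_H' hα0 hα hend hHbar
  obtain ⟨z1, z2, z3, z4⟩ := horb.exists_analyticAt_zero
  obtain ⟨o1, o2, o3, o4⟩ := horb.exists_analyticAt_endpoint hend hHbar (by linarith) hp hA
  have hρ₁ := horb.rho1_pos
  obtain ⟨He, eH, aH, tH⟩ := exists_analyticOnNhd_Icc_extension hρ₁
    (fun ρ hρ => (horb.analyticAt_of_mem_Ioo hρ).1) z1 o1
  obtain ⟨H'e, eH', aH', tH'⟩ := exists_analyticOnNhd_Icc_extension hρ₁
    (fun ρ hρ => (horb.analyticAt_of_mem_Ioo hρ).2.1) z2 o2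
  obtain ⟨Ae, eA, aA, tA⟩ := exists_analyticOnNhd_Icc_extension hρ₁
    (fun ρ hρ => (horb.analyticAt_of_mem_Ioo hρ).2.2.1) z3 o3
  obtain ⟨Ze, eZ, aZ, tZ⟩ := exists_analyticOnNhd_Icc_extension hρ₁
    (fun ρ hρ => (horb.analyticAt_of_mem_Ioo hρ).2.2.2) z4 o4
  refine ⟨He, H'e, Ae, Ze, eH, eH', eA, eZ, aH, aH', aA, aZ, fun ρ hρ => ?_, tH, tH', tA, tZ⟩
  rw [eH' hρ]
  refine (horb.hH ρ hρ).congr_of_eventuallyEq ?_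
  filter_upwards [Ioo_mem_nhds hρ.1 hρ.2] with y hy using eH hy
end
end

section
/- There exists c* > 0 such that for every c with 0 < c < c* the c-orbit has no nodes, i.e., N(c) = 0: the function H(·, c) has no zeros on [0, ρ₁(c)) (equivalently, H(ρ, c) < 0 for all ρ ∈ [0, ρ₁(c))). -/
open Real Filter Set Topology Asymptotics MeasureTheory

noncomputable section

namespace IsCOrbit

variable {α c : ℝ} {H H' A Z : ℝ → ℝ} {ρ₁ : ℝ}

lemma Ioo_mem_nhdsGT_zero (h : IsCOrbit α c H H' A Z ρ₁) : Ioo 0 ρ₁ ∈ 𝓝[>] (0 : ℝ) :=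
  Ioo_mem_nhdsGT h.rho1_pos

/-- A function with nonpositive derivative stays below its limit at the origin. -/
lemma le_of_tendsto_of_deriv_nonpos {f f' : ℝ → ℝ} {l r : ℝ}
    (hf : ∀ ρ ∈ Ioo 0 ρ₁, HasDerivAt f (f' ρ) ρ) (hf' : ∀ ρ ∈ Ioo 0 ρ₁, f' ρ ≤ 0)
    (hl : Tendsto f (𝓝[>] 0) (𝓝 l)) (hr : r ∈ Ioo 0 ρ₁) : f r ≤ l := by
  have hanti : AntitoneOn f (Ioo 0 ρ₁) := by
    apply antitoneOn_of_hasDerivWithinAt_nonpos (f' := f') (convex_Ioo 0 ρ₁)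
    · exact fun x hx => (hf x hx).continuousAt.continuousWithinAt
    · intro x hx
      rw [interior_Ioo] at hx
      exact (hf x hx).hasDerivWithinAt
    · intro x hx
      rw [interior_Ioo] at hx
      exact hf' x hx
  refine ge_of_tendsto hl ?_
  filter_upwards [Ioo_mem_nhdsGT hr.1] with x hx
  exact hanti ⟨hx.1, hx.2.trans hr.2⟩ hr hx.2.le

/-- A function tending to `0` at the origin whose derivative is nonpositive wherever the function
is positive is itself nonpositive. -/
lemma nonpos_of_deriv_nonpos_of_pos {f f' : ℝ → ℝ} {r : ℝ}
    (hf : ∀ ρ ∈ Ioo 0 ρ₁, HasDerivAt f (f' ρ) ρ) (hf' : ∀ ρ ∈ Ioo 0 ρ₁, 0 < f ρ → f' ρ ≤ 0)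
    (hl : Tendsto f (𝓝[>] 0) (𝓝 0)) (hr : r ∈ Ioo 0 ρ₁) : f r ≤ 0 := by
  refine le_of_forall_pos_le_add fun ε hε => ?_
  have hδ : 0 < ε / (1 + r) := div_pos hε (by linarith [hr.1])
  obtain ⟨a, ha, har⟩ :=
    ((hl.eventually (gt_mem_nhds hδ)).and (Ioo_mem_nhdsGT hr.1)).exists
  have key := image_le_of_deriv_right_lt_deriv_boundary (f := f) (f' := f') (a := a) (b := r)
    (B := fun x => ε / (1 + r) * (1 + (x - a))) (B' := fun _ => ε / (1 + r))
    (fun x hx => (hf x ⟨har.1.trans_le hx.1, hx.2.trans_lt hr.2⟩).continuousAt.continuousWithinAt)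
    (fun x hx => (hf x ⟨har.1.trans_le hx.1, hx.2.trans hr.2⟩).hasDerivWithinAt)
    (by simpa using ha.le)
    (fun x => by
      simpa using (((hasDerivAt_id x).sub_const a).const_add 1).const_mul (ε / (1 + r)))
    (fun x hx hfx => by
      refine (hf' x ⟨har.1.trans_le hx.1, hx.2.trans hr.2⟩ ?_).trans_lt hδ
      rw [hfx]
      exact mul_pos hδ (by linarith [hx.1]))
    (right_mem_Icc.2 har.2.le)
  calc f r ≤ ε / (1 + r) * (1 + (r - a)) := key
    _ ≤ ε / (1 + r) * (1 + r) := by gcongr; linarith [har.1]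
    _ = 0 + ε := by rw [zero_add, div_mul_cancel₀]; linarith [hr.1]

lemma le_Z (h : IsCOrbit α c H H' A Z ρ₁) (hα0 : 0 < α) {r : ℝ} (hr : r ∈ Ioo 0 ρ₁) :
    r ≤ Z r := by
  have key := le_of_tendsto_of_deriv_nonpos (f := fun ρ => -(Z ρ / ρ))
    (fun ρ hρ => ((h.hZ ρ hρ).div (hasDerivAt_id ρ) hρ.1.ne').neg) (fun ρ hρ => ?_)
    h.Z'init.neg hr
  · have := hr.1
    have h1 : 1 ≤ Z r / r := by simpa using key
    rwa [le_div_iff₀ this, one_mul] at h1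
  · have h0 := hρ.1
    obtain ⟨hz0, hz1⟩ := h.hZ01 ρ hρ
    have hz : 0 ≤ 1 - Z ρ ^ 2 := by nlinarith
    rw [neg_nonpos]
    refine div_nonneg ?_ (sq_nonneg _)
    have : Z ρ * (1 + α * (1 - Z ρ ^ 2) * ρ ^ 2 * H' ρ ^ 2) / ρ * id ρ - Z ρ * 1
        = Z ρ * (α * (1 - Z ρ ^ 2) * ρ ^ 2 * H' ρ ^ 2) := by
      simp only [id]; field_simp; ring
    rw [this]
    positivity

lemma sin_sq_le_A (h : IsCOrbit α c H H' A Z ρ₁) (hα0 : 0 < α) (hα : α < 1 / 2) {r : ℝ}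
    (hr : r ∈ Ioo 0 ρ₁) : Real.sin (H r) ^ 2 ≤ A r := by
  have hc := h.constraint r hr
  have hA := h.hApos r hr
  obtain ⟨hz0, hz1⟩ := h.hZ01 r hr
  have hz : 0 ≤ 1 - Z r ^ 2 := by nlinarith
  have h1 : 0 ≤ α * A r * r ^ 2 * H' r ^ 2 * (1 - Z r ^ 2) := by positivity
  nlinarith [Real.sin_sq_le_one (H r)]

/-- The mass-type bound `A ≤ 1 - α cos² H`. -/
lemma A_le (h : IsCOrbit α c H H' A Z ρ₁) (hα0 : 0 < α) (hα : α < 1 / 2) {r : ℝ}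
    (hr : r ∈ Ioo 0 ρ₁) : A r - 1 + α * Real.cos (H r) ^ 2 ≤ 0 := by
  refine nonpos_of_deriv_nonpos_of_pos (f := fun ρ => A ρ - 1 + α * Real.cos (H ρ) ^ 2)
    (fun ρ hρ => ((h.hA ρ hρ).sub_const 1).add (((h.hH ρ hρ).cos.pow 2).const_mul α))
    (fun ρ hρ hpos => ?_) ?_ hr
  · have h0 := hρ.1
    have hs := h.sin_sq_le_A hα0 hα hρ
    have hA := h.hApos ρ hρ
    have hc := h.constraint ρ hρ
    obtain ⟨hz0, hz1⟩ := h.hZ01 ρ hρ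
    have hz : 0 ≤ Z ρ ^ 2 := sq_nonneg _
    have hsc := Real.sin_sq_add_cos_sq (H ρ)
    set s := Real.sin (H ρ)
    set q := Real.cos (H ρ)
    set p := ρ * H' ρ with hp
    have h1 : q ^ 2 ≤ A ρ * p ^ 2 * (1 - Z ρ ^ 2) := by
      have : 0 ≤ α * (A ρ * p ^ 2 * (1 - Z ρ ^ 2) - q ^ 2) := by rw [hp]; nlinarith
      linarith [nonneg_of_mul_nonneg_right this hα0]
    have h2 : q ^ 2 ≤ A ρ * p ^ 2 := by
      have : 0 ≤ A ρ * p ^ 2 * Z ρ ^ 2 := by positivity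
      linarith
    have h3 : (q * s * p) ^ 2 ≤ (A ρ * p ^ 2) ^ 2 :=
      calc (q * s * p) ^ 2 = q ^ 2 * s ^ 2 * p ^ 2 := by ring
        _ ≤ (A ρ * p ^ 2) * A ρ * p ^ 2 := by gcongr
        _ = _ := by ring
    have h4 : -(q * s * p) ≤ A ρ * p ^ 2 :=
      (neg_le_abs _).trans (abs_le_of_sq_le_sq h3 (by positivity))
    refine nonpos_of_mul_nonpos_right (a := ρ) ?_ h0
    have : 0 ≤ α * (A ρ * p ^ 2 + q * s * p) := mul_nonneg hα0.le (by linarith)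
    rw [hp] at this
    simp only [Nat.cast_ofNat, Nat.add_one_sub_one, pow_one]
    linarith
  · have := (h.Acont.sub_const 1).add
      ((((Real.continuous_cos.tendsto _).comp h.Hcont).pow 2).const_mul α)
    simpa using this

lemma sq_sin_mul_deriv_le (h : IsCOrbit α c H H' A Z ρ₁) (hα0 : 0 < α) (hα : α < 1 / 2) {r : ℝ}
    (hr : r ∈ Ioo 0 ρ₁) :
    (Real.sin (H r) * (r * H' r)) ^ 2 * (1 - Z r ^ 2) ≤ Real.cos (H r) ^ 2 := by
  have hs := h.sin_sq_le_A hα0 hα hr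
  have hG := h.A_le hα0 hα hr
  have hc := h.constraint r hr
  obtain ⟨hz0, hz1⟩ := h.hZ01 r hr
  have hz : 0 ≤ 1 - Z r ^ 2 := by nlinarith
  have hsc := Real.sin_sq_add_cos_sq (H r)
  have h1 : A r * (r * H' r) ^ 2 * (1 - Z r ^ 2) ≤ Real.cos (H r) ^ 2 := by
    have : 0 ≤ α * (Real.cos (H r) ^ 2 - A r * (r * H' r) ^ 2 * (1 - Z r ^ 2)) := by nlinarith
    linarith [nonneg_of_mul_nonneg_right this hα0]
  rw [mul_pow]
  exact le_trans (by gcongr) h1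

lemma tendsto_cos_div (h : IsCOrbit α c H H' A Z ρ₁) :
    Tendsto (fun ρ => Real.cos (H ρ) / ρ) (𝓝[>] 0) (𝓝 c) := by
  refine HasDerivAt.lhopital_zero_nhdsGT (f' := fun ρ => -Real.sin (H ρ) * H' ρ)
    (g' := fun _ => 1) ?_ ?_ ?_ ?_ ?_ ?_
  · filter_upwards [h.Ioo_mem_nhdsGT_zero] with ρ hρ using (h.hH ρ hρ).cos
  · exact Eventually.of_forall fun ρ => hasDerivAt_id ρ
  · exact Eventually.of_forall fun _ => one_ne_zero
  · simpa [Function.comp_def] using (Real.continuous_cos.tendsto _).comp h.Hcont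
  · exact tendsto_nhdsWithin_of_tendsto_nhds tendsto_id
  · simpa using ((Real.continuous_sin.tendsto _).comp h.Hcont).neg.mul h.H'init

/-- The nonincreasing quantity `(cos H · (1 + √(1 - Z²)) / Z)²` is bounded by its limit. -/
lemma sq_cos_mul_le (h : IsCOrbit α c H H' A Z ρ₁) (hα0 : 0 < α) (hα : α < 1 / 2) {r : ℝ}
    (hr : r ∈ Ioo 0 ρ₁) :
    (Real.cos (H r) * ((1 + √(1 - Z r ^ 2)) / Z r)) ^ 2 ≤ (c * 2) ^ 2 := by
  refine le_of_tendsto_of_deriv_nonpos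
    (f := fun ρ => (Real.cos (H ρ) * ((1 + √(1 - Z ρ ^ 2)) / Z ρ)) ^ 2)
    (f' := fun ρ => 2 * ((1 + √(1 - Z ρ ^ 2)) / Z ρ) ^ 2 *
      (-(Real.cos (H ρ) * Real.sin (H ρ) * H' ρ) - Real.cos (H ρ) ^ 2 *
        (1 + α * (1 - Z ρ ^ 2) * ρ ^ 2 * H' ρ ^ 2) / (ρ * √(1 - Z ρ ^ 2))))
    (fun ρ hρ => ?_) (fun ρ hρ => ?_) ?_ hr
  · have h0 := hρ.1
    have hZ : 0 < Z ρ := h0.trans_le (h.le_Z hα0 hρ)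
    have hz1 := (h.hZ01 ρ hρ).2
    have hz : 0 < 1 - Z ρ ^ 2 := by nlinarith
    have hk : 0 < √(1 - Z ρ ^ 2) := Real.sqrt_pos.2 hz
    have hk2 : √(1 - Z ρ ^ 2) ^ 2 = 1 - Z ρ ^ 2 := Real.sq_sqrt hz.le
    have hd := h.hZ ρ hρ
    have := ((h.hH ρ hρ).cos.mul (((((hd.pow 2).const_sub 1).sqrt hz.ne').const_add 1).div hd
      hZ.ne')).pow 2
    refine this.congr_deriv ?_
    simp only [Pi.mul_apply, Pi.div_apply, Pi.pow_apply, Nat.cast_ofNat, Nat.add_one_sub_one,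
      pow_one]
    generalize √(1 - Z ρ ^ 2) = k at *
    have e : Z ρ ^ 2 = 1 - k ^ 2 := by linarith
    generalize 1 + α * (1 - Z ρ ^ 2) * ρ ^ 2 * H' ρ ^ 2 = W
    field_simp
    linear_combination -(Real.cos (H ρ) ^ 2 * W) * e
  · have h0 := hρ.1
    have hz1 := h.hZ01 ρ hρ
    have hz : 0 < 1 - Z ρ ^ 2 := by nlinarith
    have hk : 0 < √(1 - Z ρ ^ 2) := Real.sqrt_pos.2 hz
    have hk2 : √(1 - Z ρ ^ 2) ^ 2 = 1 - Z ρ ^ 2 := Real.sq_sqrt hz.le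
    have hb := h.sq_sin_mul_deriv_le hα0 hα hρ
    refine mul_nonpos_of_nonneg_of_nonpos (by positivity) ?_
    rw [sub_nonpos, le_div_iff₀ (by positivity)]
    have h1 : |Real.sin (H ρ) * (ρ * H' ρ) * √(1 - Z ρ ^ 2)| ≤ |Real.cos (H ρ)| := by
      rw [← sq_le_sq, mul_pow, hk2]
      exact hb
    have h2 : 0 ≤ Real.cos (H ρ) ^ 2 * (α * (1 - Z ρ ^ 2) * ρ ^ 2 * H' ρ ^ 2) := by positivity
    calc -(Real.cos (H ρ) * Real.sin (H ρ) * H' ρ) * (ρ * √(1 - Z ρ ^ 2))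
        = -(Real.cos (H ρ) * (Real.sin (H ρ) * (ρ * H' ρ) * √(1 - Z ρ ^ 2))) := by ring
      _ ≤ |Real.cos (H ρ) * (Real.sin (H ρ) * (ρ * H' ρ) * √(1 - Z ρ ^ 2))| := neg_le_abs _
      _ ≤ |Real.cos (H ρ)| * |Real.cos (H ρ)| := by rw [abs_mul]; gcongr
      _ = Real.cos (H ρ) ^ 2 := by rw [abs_mul_abs_self, sq]
      _ ≤ _ := by linarith
  · have hsq : Tendsto (fun ρ => 1 + √(1 - Z ρ ^ 2)) (𝓝[>] 0) (𝓝 2) := by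
      have := ((h.Zcont.pow 2).const_sub 1).sqrt.const_add 1
      norm_num at this
      exact this
    have := ((h.tendsto_cos_div.div h.Z'init one_ne_zero).mul hsq).pow 2
    rw [div_one] at this
    refine this.congr' ?_
    filter_upwards [h.Ioo_mem_nhdsGT_zero] with ρ hρ
    have h0 := hρ.1
    have hZ : 0 < Z ρ := h0.trans_le (h.le_Z hα0 hρ)
    simp only [Pi.div_apply]
    field_simp

lemma cos_sq_lt_one (h : IsCOrbit α c H H' A Z ρ₁) (hα0 : 0 < α) (hα : α < 1 / 2)
    (hc0 : 0 < c) (hc : c < 1 / 2) {r : ℝ} (hr : r ∈ Ioo 0 ρ₁) : Real.cos (H r) ^ 2 < 1 := by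
  have hZ : 0 < Z r := hr.1.trans_le (h.le_Z hα0 hr)
  have h1 : 1 ≤ (1 + √(1 - Z r ^ 2)) / Z r := by
    rw [le_div_iff₀ hZ]
    linarith [(h.hZ01 r hr).2, Real.sqrt_nonneg (1 - Z r ^ 2)]
  calc Real.cos (H r) ^ 2 ≤ Real.cos (H r) ^ 2 * ((1 + √(1 - Z r ^ 2)) / Z r) ^ 2 :=
        le_mul_of_one_le_right (sq_nonneg _) (one_le_pow₀ h1)
    _ = (Real.cos (H r) * ((1 + √(1 - Z r ^ 2)) / Z r)) ^ 2 := by ring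
    _ ≤ (c * 2) ^ 2 := h.sq_cos_mul_le hα0 hα hr
    _ < 1 := by nlinarith

lemma H_neg (h : IsCOrbit α c H H' A Z ρ₁) (hα0 : 0 < α) (hα : α < 1 / 2)
    (hc0 : 0 < c) (hc : c < 1 / 2) {r : ℝ} (hr : r ∈ Ico 0 ρ₁) : H r < 0 := by
  rcases hr.1.eq_or_lt with rfl | h0
  · rw [h.H0]
    linarith [Real.pi_pos]
  by_contra! hpos
  have hπ : -(π / 2) < 0 := by linarith [Real.pi_pos]
  obtain ⟨a, ha, har⟩ :=
    ((h.Hcont.eventually (gt_mem_nhds hπ)).and (Ioo_mem_nhdsGT h0)).exists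
  have hcont : ContinuousOn H (Icc a r) := fun x hx =>
    (h.hH x ⟨har.1.trans_le hx.1, hx.2.trans_lt hr.2⟩).continuousAt.continuousWithinAt
  obtain ⟨x, hx, hx0⟩ := intermediate_value_Icc har.2.le hcont ⟨ha.le, hpos⟩
  have := h.cos_sq_lt_one hα0 hα hc0 hc ⟨har.1.trans_le hx.1, hx.2.trans_lt hr.2⟩
  simp [hx0] at this

end IsCOrbit

/-- Proposition 6: for sufficiently small `c > 0` the `c`-orbit has no nodes,
i.e. `H(·, c) < 0` (hence has no zeros) on `[0, ρ₁(c))`. -/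
theorem proposition6 (α : ℝ) (hα0 : 0 < α) (hα : α < 1 / 2) :
    ∃ cstar > (0:ℝ), ∀ c, 0 < c → c < cstar →
      ∀ (H H' A Z : ℝ → ℝ) (ρ₁ : ℝ),
        IsCOrbit α c H H' A Z ρ₁ → Tendsto Z (𝓝[<] ρ₁) (𝓝 1) →
        ∀ ρ ∈ Set.Ico 0 ρ₁, H ρ < 0 := by
  exact ⟨1 / 2, by norm_num, fun c hc0 hc H H' A Z ρ₁ h _ ρ hρ => h.H_neg hα0 hα hc0 hc hρ⟩
end
end
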